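/- arXiv:math/9711222 — 2 statements merged into one kernel-verified Lean document; each statement's English description precedes it below -/
import Mathlib

section
/- cov*(𝒩) ≥ max{𝔟, non(𝒮ℳ)}. -/
open Cardinal MeasureTheory Set Filter Pointwise

/-- `cov*(𝒩)`: the least cardinality of a family `𝒜` of null subsets of the plane such that
for every Borel function `f : ℝ → ℝ` and every Borel set `B ⊆ ℝ` of positive Lebesgue measure
there is `H ∈ 𝒜` with `{x ∈ B : (x, f x) ∈ H}` not Lebesgue-null. -/
noncomputable def covStarN : Cardinal :=
  sInf { c : Cardinal | ∃ A : Set (Set (ℝ × ℝ)), #A = c ∧ (∀ H ∈ A, volume H = 0) ∧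
    ∀ f : ℝ → ℝ, Measurable f → ∀ B : Set ℝ, MeasurableSet B → 0 < volume B →
      ∃ H ∈ A, volume {x | x ∈ B ∧ (x, f x) ∈ H} ≠ 0 }

/-- The unbounding number `𝔟`. -/
noncomputable def frakb : Cardinal :=
  sInf { c : Cardinal | ∃ F : Set (ℕ → ℕ), #F = c ∧
    ∀ g : ℕ → ℕ, ∃ f ∈ F, ¬ ∀ᶠ n in atTop, f n ≤ g n }

/-- The Cantor space `2^ω` as the additive group `ℕ → ZMod 2`
(coordinatewise addition modulo 2). -/
abbrev Cantor : Type := ℕ → ZMod 2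

instance : TopologicalSpace (ZMod 2) := ⊥
instance : DiscreteTopology (ZMod 2) := ⟨rfl⟩
noncomputable instance : MeasurableSpace Cantor := borel _
instance : BorelSpace Cantor := ⟨rfl⟩

/-- The uniform product probability measure on `2^ω`, i.e. the normalized Haar measure of the
compact group `ℕ → ZMod 2`. -/
noncomputable def cantorMeasure : Measure Cantor :=
  Measure.addHaarMeasure (⊤ : TopologicalSpace.PositiveCompacts Cantor)

/-- `X ⊆ 2^ω` is strongly meager iff `X + H ≠ 2^ω` for every measure-zero `H`. -/
def StronglyMeager (X : Set Cantor) : Prop :=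
  ∀ H : Set Cantor, cantorMeasure H = 0 → X + H ≠ Set.univ

/-- `non(𝒮ℳ)`: the least cardinality of a subset of `2^ω` that is not strongly meager. -/
noncomputable def nonSM : Cardinal :=
  sInf { c : Cardinal | ∃ X : Set Cantor, #X = c ∧ ¬ StronglyMeager X }


instance : cantorMeasure.IsAddHaarMeasure := by unfold cantorMeasure; infer_instance

instance : IsProbabilityMeasure cantorMeasure :=
  ⟨Measure.addHaarMeasure_self (K₀ := (⊤ : TopologicalSpace.PositiveCompacts Cantor))⟩

/-- The product of two copies of the uniform measure on `2^ω`. -/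
noncomputable abbrev cantorSq : Measure (Cantor × Cantor) := cantorMeasure.prod cantorMeasure

/-- Replace the first `l.length` coordinates of the second component of `p` by coordinates of the
first component: the `k`-th one becomes the coordinate with index `Nat.pair k l[k]`. -/
def graft (l : List ℕ) (p : Cantor × Cantor) : Cantor × Cantor :=
  (p.1, fun k => (l[k]?).elim (p.2 k) fun i => p.1 (Nat.pair k i))

/-- The limit of `graft` along longer and longer initial segments of `t`. -/
def select (t : ℕ → ℕ) (r : Cantor) : Cantor := fun k => r (Nat.pair k (t k))

/-- The expectation of `F` after grafting along `l`. -/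
noncomputable def graftMean (F : Cantor × Cantor → ENNReal) (l : List ℕ) : ENNReal :=
  ∫⁻ p, F (graft l p) ∂cantorSq

/-- The one-step extensions of `l` along which the grafted expectation of `F` jumps by more
than `2 ^ (-l.length)`. -/
def badStep (F : Cantor × Cantor → ENNReal) (l : List ℕ) : Set ℕ :=
  {i | graftMean F l + (2 ^ l.length)⁻¹ < graftMean F (l ++ [i])}

lemma continuous_select (t : ℕ → ℕ) : Continuous (select t) := by
  unfold select; fun_prop

lemma continuous_graft (l : List ℕ) : Continuous (graft l) := by
  unfold graft
  refine continuous_fst.prodMk (continuous_pi fun k => ?_)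
  cases h : l[k]? with
  | none => simp only [Option.elim]; fun_prop
  | some i => simp only [Option.elim]; fun_prop

lemma graft_nil (p : Cantor × Cantor) : graft [] p = p := by
  simp [graft]

lemma graft_append (l : List ℕ) (i : ℕ) (p : Cantor × Cantor) :
    graft (l ++ [i]) p =
      (p.1, Function.update (graft l p).2 l.length (p.1 (Nat.pair l.length i))) := by
  refine Prod.ext rfl (funext fun k => ?_)
  rcases lt_trichotomy k l.length with h | h | h
  · simp [graft, h.ne, List.getElem?_append_left h]
  · subst h; simp [graft]
  · have h1 : (l ++ [i])[k]? = none := by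
      rw [List.getElem?_eq_none_iff]; simp; omega
    have h2 : l[k]? = none := by rw [List.getElem?_eq_none_iff]; omega
    simp [graft, h.ne', h1, h2]

lemma graft_add_single (l : List ℕ) (p : Cantor × Cantor) :
    graft l (p + (0, Pi.single l.length 1)) =
      (p.1, (graft l p).2 + Pi.single l.length 1) := by
  refine Prod.ext (by simp [graft]) (funext fun k => ?_)
  cases h : l[k]? with
  | none => simp [graft, h]
  | some i =>
    have : k ≠ l.length := by
      rintro rfl; simp at h
    simp [graft, h, this]

lemma zmod_two_cases (c : ZMod 2) : c = 0 ∨ c = 1 := by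
  revert c; decide

lemma update_zero_add_update_one (G : Cantor → ENNReal) (w : Cantor) (n : ℕ) :
    G (Function.update w n 0) + G (Function.update w n 1) = G w + G (w + Pi.single n 1) := by
  have key : w + Pi.single n 1 = Function.update w n (w n + 1) := by
    funext k
    by_cases hk : k = n
    · subst hk; simp
    · simp [hk]
  have h0 : w = Function.update w n (w n) := (Function.update_eq_self n w).symm
  rcases zmod_two_cases (w n) with h | h
  · rw [key, h, zero_add]; rw [h] at h0; rw [← h0]
  · have h2 : (1 : ZMod 2) + 1 = 0 := by decide
    rw [key, h, h2]; rw [h] at h0; rw [← h0, add_comm]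

lemma lintegral_update_add_update (G : Cantor × Cantor → ENNReal) (hG : Measurable G)
    (l : List ℕ) :
    ∫⁻ p, (G (p.1, Function.update (graft l p).2 l.length 0) +
      G (p.1, Function.update (graft l p).2 l.length 1)) ∂cantorSq = 2 * graftMean G l := by
  have h : ∀ p : Cantor × Cantor, G (p.1, Function.update (graft l p).2 l.length 0) +
      G (p.1, Function.update (graft l p).2 l.length 1) =
      G (graft l p) + G (graft l (p + (0, Pi.single l.length 1))) := fun p => by
    rw [update_zero_add_update_one (fun w => G (p.1, w)), graft_add_single]; rfl
  simp_rw [h]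
  have hm : Measurable fun p => G (graft l p) := hG.comp (continuous_graft l).measurable
  rw [lintegral_add_left hm,
    lintegral_add_right_eq_self (fun p => G (graft l p)), two_mul, graftMean]

lemma graftMean_append_le (G : Cantor × Cantor → ENNReal) (hG : Measurable G) (l : List ℕ)
    (i : ℕ) : graftMean G (l ++ [i]) ≤ 2 * graftMean G l := by
  rw [← lintegral_update_add_update G hG]
  refine lintegral_mono fun p => ?_
  rw [graft_append]
  rcases zmod_two_cases (p.1 (Nat.pair l.length i)) with h | h <;> rw [h]
  · exact le_self_add
  · exact le_add_self

lemma graftMean_le (G : Cantor × Cantor → ENNReal) (hG : Measurable G)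
    (h1 : ∫⁻ p, G p ∂cantorSq ≤ 1) (l : List ℕ) : graftMean G l ≤ 2 ^ l.length := by
  induction l using List.reverseRecOn with
  | nil => simpa [graftMean, graft_nil] using h1
  | append_singleton l i ih =>
    refine (graftMean_append_le G hG l i).trans ?_
    rw [List.length_append, List.length_singleton, pow_succ, mul_comm]
    gcongr

lemma graftMean_ne_top (F : Cantor × Cantor → ENNReal) (hF : Measurable F)
    (h1 : ∫⁻ p, F p ^ 2 ∂cantorSq ≤ 1) (l : List ℕ) : graftMean F l ≠ ⊤ := by
  have hsq := graftMean_le _ (hF.pow_const 2) h1 l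
  have : graftMean F l ≤ graftMean (fun p => F p ^ 2 + 1) l := by
    refine lintegral_mono fun p => ?_
    rcases le_total (F (graft l p)) 1 with h | h
    · exact h.trans le_add_self
    · exact (le_self_pow h two_ne_zero).trans le_self_add
  refine ne_top_of_le_ne_top ?_ this
  unfold graftMean at hsq ⊢
  rw [lintegral_add_right _ measurable_const]
  simpa using ne_top_of_le_ne_top (by finiteness) hsq

/-- The sign `±1` attached to a bit. -/
noncomputable def bitSign (c : ZMod 2) : ℝ := if c = 0 then 1 else -1

lemma bitSign_add_one (c : ZMod 2) : bitSign (c + 1) = -bitSign c := by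
  rcases zmod_two_cases c with rfl | rfl
  · simp [bitSign]
  · have h2 : (1 : ZMod 2) + 1 = 0 := by decide
    simp [bitSign, h2]

lemma bitSign_sq (c : ZMod 2) : bitSign c ^ 2 = 1 := by
  unfold bitSign; split_ifs <;> norm_num

lemma measurable_sum_bitSign (n : ℕ) (I : Finset ℕ) :
    Measurable fun p : Cantor × Cantor => ∑ i ∈ I, bitSign (p.1 (Nat.pair n i)) := by
  refine Continuous.measurable (continuous_finsetSum _ fun i _ => ?_)
  have : Continuous bitSign := continuous_of_discreteTopology
  fun_prop

lemma lintegral_sum_bitSign_sq (n : ℕ) (I : Finset ℕ) :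
    ∫⁻ p, ENNReal.ofReal ((∑ i ∈ I, bitSign (p.1 (Nat.pair n i))) ^ 2) ∂cantorSq = I.card := by
  induction I using Finset.induction_on with
  | empty => simp
  | insert j I hj ih =>
    have hm := fun J : Finset ℕ =>
      ((measurable_sum_bitSign n J).pow_const 2).ennreal_ofReal
    set D : Cantor × Cantor → ENNReal := fun p =>
      ENNReal.ofReal ((∑ i ∈ insert j I, bitSign (p.1 (Nat.pair n i))) ^ 2) with hD
    have hflip : ∀ p : Cantor × Cantor,
        D p + D (p + (Pi.single (Nat.pair n j) 1, 0)) =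
        2 * ENNReal.ofReal ((∑ i ∈ I, bitSign (p.1 (Nat.pair n i))) ^ 2) + 2 := fun p => by
      have hs : ∑ i ∈ I, bitSign ((p + (Pi.single (Nat.pair n j) 1, 0)).1 (Nat.pair n i)) =
          ∑ i ∈ I, bitSign (p.1 (Nat.pair n i)) := by
        refine Finset.sum_congr rfl fun i hi => ?_
        have : i ≠ j := fun h => hj (h ▸ hi)
        have h3 : Nat.pair n i ≠ Nat.pair n j := fun h => this (Nat.pair_eq_pair.1 h).2
        simp [h3]
      have hjj : bitSign ((p + (Pi.single (Nat.pair n j) 1, 0)).1 (Nat.pair n j)) =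
          - bitSign (p.1 (Nat.pair n j)) := by
        rw [← bitSign_add_one]; simp
      simp only [hD, Finset.sum_insert hj]
      rw [hs, hjj, ← ENNReal.ofReal_add (sq_nonneg _) (sq_nonneg _)]
      rw [show (2 : ENNReal) = ENNReal.ofReal 2 by simp,
        ← ENNReal.ofReal_mul (by norm_num), ← ENNReal.ofReal_add (by positivity) (by norm_num)]
      congr 1
      have := bitSign_sq (p.1 (Nat.pair n j))
      linear_combination 2 * this
    have h2 : 2 * ∫⁻ p, D p ∂cantorSq = 2 * (I.card + 1) := by
      calc 2 * ∫⁻ p, D p ∂cantorSq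
          = ∫⁻ p, (D p + D (p + (Pi.single (Nat.pair n j) 1, 0))) ∂cantorSq := by
            rw [lintegral_add_left (hm _), lintegral_add_right_eq_self D, two_mul]
        _ = 2 * (I.card + 1) := by
            simp_rw [hflip]
            rw [lintegral_add_left ((hm _).const_mul 2), lintegral_const_mul _ (hm _), ih]
            simp [mul_add]
    rw [Finset.card_insert_of_notMem hj]
    push_cast
    exact (ENNReal.mul_right_inj (by norm_num) (by norm_num)).1 h2

lemma sum_ite_le (a b : ENNReal) (q : ℕ) (hq : 0 < q) (I : Finset ℕ) (c : ℕ → ZMod 2) :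
    4 * q * ∑ i ∈ I, (if c i = 0 then a else b) ≤
      2 * I.card * q * (a + b) + ENNReal.ofReal ((∑ i ∈ I, bitSign (c i)) ^ 2) +
        q ^ 2 * (a ^ 2 + b ^ 2) := by
  have hq' : (q : ENNReal) ^ 2 ≠ 0 := by positivity
  by_cases ha : a = ⊤
  · subst ha; simp [ENNReal.mul_top hq']
  by_cases hb : b = ⊤
  · subst hb; simp [ENNReal.mul_top hq']
  lift a to NNReal using ha
  lift b to NNReal using hb
  have e1 : ∑ i ∈ I, (if c i = 0 then (a : ENNReal) else b) =
      ENNReal.ofReal (∑ i ∈ I, (if c i = 0 then (a : ℝ) else b)) := by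
    rw [ENNReal.ofReal_sum_of_nonneg (fun i _ => by split_ifs <;> exact NNReal.coe_nonneg _)]
    refine Finset.sum_congr rfl fun i _ => ?_
    split_ifs <;> simp
  have e2 : ∑ i ∈ I, (if c i = 0 then (a : ℝ) else b) =
      I.card * ((a + b) / 2) + (∑ i ∈ I, bitSign (c i)) * ((a - b) / 2) := by
    rw [← nsmul_eq_mul, ← Finset.sum_const, Finset.sum_mul, ← Finset.sum_add_distrib]
    refine Finset.sum_congr rfl fun i _ => ?_
    unfold bitSign; split_ifs <;> ring
  set S := ∑ i ∈ I, bitSign (c i)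
  rw [e1, e2]
  have ha : (a : ENNReal) = ENNReal.ofReal (a : ℝ) := by simp
  have hb : (b : ENNReal) = ENNReal.ofReal (b : ℝ) := by simp
  have hqq : (q : ENNReal) = ENNReal.ofReal (q : ℝ) := by simp
  have hI : (I.card : ENNReal) = ENNReal.ofReal (I.card : ℝ) := by simp
  have h4 : (4 : ENNReal) = ENNReal.ofReal 4 := by simp
  have h2 : (2 : ENNReal) = ENNReal.ofReal 2 := by simp
  have ha0 : (0 : ℝ) ≤ a := a.2
  have hb0 : (0 : ℝ) ≤ b := b.2
  rw [ha, hb, hqq, hI, h4, h2]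
  rw [← ENNReal.ofReal_pow ha0, ← ENNReal.ofReal_pow hb0, ← ENNReal.ofReal_pow (by positivity),
    ← ENNReal.ofReal_add (by positivity) (by positivity),
    ← ENNReal.ofReal_add (by positivity) (by positivity),
    ← ENNReal.ofReal_mul (by positivity), ← ENNReal.ofReal_mul (by positivity),
    ← ENNReal.ofReal_mul (by positivity), ← ENNReal.ofReal_mul (by positivity),
    ← ENNReal.ofReal_mul (by positivity), ← ENNReal.ofReal_mul (by positivity),
    ← ENNReal.ofReal_add (by positivity) (by positivity),
    ← ENNReal.ofReal_add (by positivity) (by positivity)]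
  refine ENNReal.ofReal_le_ofReal ?_
  have hab : 0 ≤ (q : ℝ) ^ 2 * (2 * (a * b)) := by positivity
  nlinarith [sq_nonneg (S - q * (a - b))]

lemma card_le_of_subset_badStep (F : Cantor × Cantor → ENNReal) (hF : Measurable F)
    (h1 : ∫⁻ p, F p ^ 2 ∂cantorSq ≤ 1) (l : List ℕ) (I : Finset ℕ)
    (hI : (I : Set ℕ) ⊆ badStep F l) : I.card ≤ 8 ^ l.length := by
  set q : ℕ := 2 ^ l.length with hq
  have hq0 : 0 < q := by positivity
  have hF2 : Measurable fun p => F p ^ 2 := hF.pow_const 2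
  have hsq : graftMean (fun p => F p ^ 2) l ≤ q := by
    have := graftMean_le _ hF2 h1 l
    simpa [hq] using this
  have hfin : graftMean F l ≠ ⊤ := graftMean_ne_top F hF h1 l
  set S : Cantor × Cantor → ENNReal := fun p =>
    ENNReal.ofReal ((∑ i ∈ I, bitSign (p.1 (Nat.pair l.length i))) ^ 2) with hS
  have hSm : Measurable S := ((measurable_sum_bitSign _ I).pow_const 2).ennreal_ofReal
  have hu : ∀ c : ZMod 2, Measurable fun p : Cantor × Cantor =>
      F (p.1, Function.update (graft l p).2 l.length c) := fun c => by
    refine hF.comp (Continuous.measurable ?_)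
    exact continuous_fst.prodMk
      (((continuous_snd.comp (continuous_graft l))).update _ continuous_const)
  have hmain : 4 * q * ∑ i ∈ I, graftMean F (l ++ [i]) ≤
      2 * I.card * q * (2 * graftMean F l) + ∫⁻ p, S p ∂cantorSq +
        q ^ 2 * (2 * graftMean (fun p => F p ^ 2) l) := by
    rw [← lintegral_update_add_update F hF, ← lintegral_update_add_update _ hF2]
    unfold graftMean
    have hg : ∀ i ∈ I, Measurable fun p => F (graft (l ++ [i]) p) := fun i _ =>
      hF.comp (continuous_graft (l ++ [i])).measurable
    have hm : Measurable fun p : Cantor × Cantor => (q : ENNReal) ^ 2 *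
        (F (p.1, Function.update (graft l p).2 l.length 0) ^ 2 +
          F (p.1, Function.update (graft l p).2 l.length 1) ^ 2) :=
      (((hu 0).pow_const 2).add ((hu 1).pow_const 2)).const_mul _
    rw [← lintegral_finsetSum I hg]
    rw [← lintegral_const_mul' _ _ (by finiteness), ← lintegral_const_mul' _ _ (by finiteness),
      ← lintegral_const_mul' _ _ (by finiteness), ← lintegral_add_right _ hSm,
      ← lintegral_add_right _ hm]
    refine lintegral_mono fun p => ?_
    refine le_trans (le_of_eq ?_) (sum_ite_le _ _ q hq0 I fun i => p.1 (Nat.pair l.length i))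
    congr 1
    refine Finset.sum_congr rfl fun i _ => ?_
    rw [graft_append]
    rcases zmod_two_cases (p.1 (Nat.pair l.length i)) with h | h <;> simp [h]
  rw [lintegral_sum_bitSign_sq] at hmain
  have hlow : 4 * q * (I.card * (graftMean F l + (q : ENNReal)⁻¹)) ≤
      4 * q * ∑ i ∈ I, graftMean F (l ++ [i]) := by
    gcongr
    rw [← nsmul_eq_mul, ← Finset.sum_const]
    refine Finset.sum_le_sum fun i hi => ?_
    have h : graftMean F l + (2 ^ l.length)⁻¹ < graftMean F (l ++ [i]) := hI hi
    simpa [hq] using h.le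
  have hqi : (q : ENNReal) * (q : ENNReal)⁻¹ = 1 :=
    ENNReal.mul_inv_cancel (by positivity) (by finiteness)
  have hfinal : 4 * q * I.card * graftMean F l + 4 * I.card ≤
      4 * q * I.card * graftMean F l + (I.card + 2 * q ^ 3) := by
    calc 4 * q * I.card * graftMean F l + 4 * I.card
        = 4 * q * (I.card * (graftMean F l + (q : ENNReal)⁻¹)) := by
          rw [mul_add, mul_add, show 4 * (q : ENNReal) * (I.card * (q : ENNReal)⁻¹) =
            4 * I.card * (q * (q : ENNReal)⁻¹) by ring, hqi]
          ring
      _ ≤ _ := hlow.trans hmain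
      _ ≤ 2 * I.card * q * (2 * graftMean F l) + I.card + q ^ 2 * (2 * q) := by gcongr
      _ = _ := by ring
  have h3 := (ENNReal.add_le_add_iff_left (by finiteness)).1 hfinal
  have h4 : 4 * I.card ≤ I.card + 2 * q ^ 3 := by exact_mod_cast h3
  have h5 : q ^ 3 = 8 ^ l.length := by
    rw [hq, ← pow_mul, mul_comm, pow_mul]; norm_num
  omega

lemma tendsto_graft_map_range (t : ℕ → ℕ) (p : Cantor × Cantor) :
    Tendsto (fun n => graft ((List.range n).map t) p) atTop (nhds (p.1, select t p.1)) := by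
  refine Tendsto.prodMk_nhds tendsto_const_nhds (tendsto_pi_nhds.2 fun k => ?_)
  refine tendsto_const_nhds.congr' ?_
  filter_upwards [eventually_gt_atTop k] with n hn
  simp [select, hn]

lemma lintegral_select_ne_top (F : Cantor × Cantor → ENNReal) (hF : LowerSemicontinuous F)
    (h1 : ∫⁻ p, F p ^ 2 ∂cantorSq ≤ 1) (t : ℕ → ℕ)
    (ht : ∀ᶠ n in atTop, t n ∉ badStep F ((List.range n).map t)) :
    ∫⁻ p, F (p.1, select t p.1) ∂cantorSq ≠ ⊤ := by
  obtain ⟨n₀, hn₀⟩ := eventually_atTop.1 ht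
  set E : ℕ → ENNReal := fun n => graftMean F ((List.range n).map t) with hE
  have hstep : ∀ n ≥ n₀, E (n + 1) ≤ E n + (2 ^ n)⁻¹ := fun n hn => by
    have := hn₀ n hn
    simpa [badStep, hE, List.range_succ] using this
  have hhalf : ∀ n : ℕ, ((2 : ENNReal) ^ n)⁻¹ = 2 * (2 ^ (n + 1))⁻¹ := fun n => by
    rw [pow_succ, ENNReal.mul_inv (by simp) (by simp), mul_comm, mul_assoc,
      ENNReal.inv_mul_cancel (by simp) (by simp), mul_one]
  have hbound : ∀ n ≥ n₀, E n + 2 * (2 ^ n)⁻¹ ≤ E n₀ + 2 * (2 ^ n₀)⁻¹ := fun n hn => by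
    induction n, hn using Nat.le_induction with
    | base => exact le_rfl
    | succ n hn ih =>
      refine le_trans ?_ ih
      rw [← hhalf, two_mul, ← add_assoc]
      gcongr
      exact hstep n hn
  have hfin : E n₀ ≠ ⊤ := graftMean_ne_top F hF.measurable h1 _
  refine ne_top_of_le_ne_top (b := E n₀ + 2 * (2 ^ n₀)⁻¹) (by finiteness) ?_
  calc ∫⁻ p, F (p.1, select t p.1) ∂cantorSq
      ≤ ∫⁻ p, liminf (fun n => F (graft ((List.range n).map t) p)) atTop ∂cantorSq := by
        refine lintegral_mono fun p => (hF.le_liminf _).trans ?_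
        exact liminf_le_liminf_of_le (tendsto_graft_map_range t p)
    _ ≤ liminf E atTop := lintegral_liminf_le fun n =>
        hF.measurable.comp (continuous_graft _).measurable
    _ ≤ _ := by
        refine liminf_le_of_frequently_le' (Eventually.frequently ?_)
        filter_upwards [eventually_ge_atTop n₀] with n hn
        exact le_self_add.trans (hbound n hn)

lemma exists_lowerSemicontinuous_eq_top (N : Set (Cantor × Cantor)) (hN : cantorSq N = 0) :
    ∃ F : Cantor × Cantor → ENNReal, LowerSemicontinuous F ∧ ∫⁻ p, F p ^ 2 ∂cantorSq ≤ 1 ∧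
      ∀ p ∈ N, F p = ⊤ := by
  obtain ⟨ε, hε, hsum⟩ := ENNReal.exists_pos_sum_of_countable (one_ne_zero (α := ENNReal)) ℕ
  have hU : ∀ m : ℕ, ∃ U ⊇ N, IsOpen U ∧ cantorSq U < ε m := fun m =>
    N.exists_isOpen_lt_of_lt _ (by rw [hN]; exact_mod_cast hε m)
  choose U hNU hUo hUε using hU
  set G : Cantor × Cantor → ENNReal := fun p => ∑' m, (U m).indicator (fun _ => 1) p with hG
  have hGl : LowerSemicontinuous G :=
    lowerSemicontinuous_tsum fun m => (hUo m).lowerSemicontinuous_indicator zero_le_one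
  refine ⟨fun p => G p ^ (1 / 2 : ℝ), ?_, ?_, fun p hp => ?_⟩
  · exact ENNReal.continuous_rpow_const.comp_lowerSemicontinuous hGl
      (ENNReal.monotone_rpow_of_nonneg (by norm_num))
  · have : ∀ p, (G p ^ (1 / 2 : ℝ)) ^ 2 = G p := fun p => by
      rw [← ENNReal.rpow_natCast, ← ENNReal.rpow_mul]; norm_num
    simp_rw [this, hG]
    rw [lintegral_tsum fun m =>
      ((measurable_const.indicator (hUo m).measurableSet).aemeasurable)]
    refine le_trans (ENNReal.tsum_le_tsum fun m => ?_) hsum.le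
    rw [lintegral_indicator_const (hUo m).measurableSet, one_mul]
    exact (hUε m).le
  · have : G p = ⊤ := by
      simp [hG, fun m => hNU m hp]
    simp [this]

lemma exists_bad_of_null (N : Set (Cantor × Cantor)) (hN : cantorSq N = 0) :
    ∃ bad : List ℕ → Set ℕ,
      (∀ l, ∀ I : Finset ℕ, (I : Set ℕ) ⊆ bad l → I.card ≤ 8 ^ l.length) ∧
      ∀ t : ℕ → ℕ, (∀ᶠ n in atTop, t n ∉ bad ((List.range n).map t)) →
        cantorMeasure {r | (r, select t r) ∈ N} = 0 := by
  obtain ⟨F, hF, h1, htop⟩ := exists_lowerSemicontinuous_eq_top N hN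
  refine ⟨badStep F, card_le_of_subset_badStep F hF.measurable h1, fun t ht => ?_⟩
  have hm : Measurable fun p : Cantor × Cantor => F (p.1, select t p.1) :=
    hF.measurable.comp
      (continuous_fst.prodMk ((continuous_select t).comp continuous_fst)).measurable
  have hae := ae_lt_top hm (lintegral_select_ne_top F hF h1 t ht)
  have hsub : {r | (r, select t r) ∈ N} ×ˢ (univ : Set Cantor) ⊆
      {p | ¬ F (p.1, select t p.1) < ⊤} := by
    rintro p ⟨hp, -⟩
    simp [htop _ hp]
  have := measure_mono_null hsub hae
  simpa [Measure.prod_prod] using this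

lemma cantorMeasure_agree (S : Finset ℕ) (a : Cantor) :
    cantorMeasure {x | ∀ k ∈ S, x k = a k} = (2 ^ S.card)⁻¹ := by
  induction S using Finset.induction_on with
  | empty => simp
  | insert j S hj ih =>
    set A := {x : Cantor | ∀ k ∈ insert j S, x k = a k} with hA
    have hAm : MeasurableSet A := by
      refine IsClosed.measurableSet ?_
      simp only [hA, ofPred_forall]
      exact isClosed_iInter fun k => isClosed_iInter fun _ =>
        isClosed_eq (continuous_apply k) continuous_const
    have hsplit : {x : Cantor | ∀ k ∈ S, x k = a k} =
        A ∪ (fun x => x + Pi.single j 1) ⁻¹' A := by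
      ext x
      have h1 : ∀ k ∈ S, (x + Pi.single j 1 : Cantor) k = x k := fun k hk => by
        have : k ≠ j := fun h => hj (h ▸ hk)
        simp [this]
      have h2 : x j = a j ∨ x j + 1 = a j := by
        generalize x j = u
        generalize a j = v
        revert u v; decide
      simp only [hA, mem_ofPred_eq, mem_union, mem_preimage, Finset.forall_mem_insert]
      have h3 : (x + Pi.single j 1 : Cantor) j = x j + 1 := by simp
      rw [h3]
      have h4 : (∀ k ∈ S, (x + Pi.single j 1 : Cantor) k = a k) ↔ ∀ k ∈ S, x k = a k :=
        forall₂_congr fun k hk => by rw [h1 k hk]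
      rw [h4]
      tauto
    have hdisj : Disjoint A ((fun x => x + Pi.single j 1) ⁻¹' A) := by
      refine Set.disjoint_left.2 fun x hx hx' => ?_
      have h1 : x j = a j := hx j (Finset.mem_insert_self _ _)
      have h2 : x j + 1 = a j := by simpa using hx' j (Finset.mem_insert_self _ _)
      rw [h1] at h2
      simp at h2
    rw [hsplit, measure_union hdisj (hAm.preimage (measurable_add_const _)),
      measure_preimage_add_right, ← two_mul] at ih
    rw [Finset.card_insert_of_notMem hj, pow_succ, ENNReal.mul_inv (by simp) (by simp), ← ih,
      mul_comm 2, mul_assoc, ENNReal.mul_inv_cancel (by simp) (by simp), mul_one]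

/-- The binary digits of (the fractional part of) a real number. -/
noncomputable def binaryDigits (x : ℝ) : Cantor := fun i => ((⌊2 ^ (i + 1) * x⌋ : ℤ) : ZMod 2)

/-- The integer whose binary digits are the first `n` bits of `a`. -/
def prefixValue (a : Cantor) : ℕ → ℤ
  | 0 => 0
  | n + 1 => 2 * prefixValue a n + (a n).val

lemma floor_two_mul_eq_iff (y : ℝ) (k : ℤ) (c : ZMod 2) :
    ⌊2 * y⌋ = 2 * k + c.val ↔ ⌊y⌋ = k ∧ ((⌊2 * y⌋ : ℤ) : ZMod 2) = c := by
  have h1 : 2 * ⌊y⌋ ≤ ⌊2 * y⌋ := by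
    rw [Int.le_floor]; push_cast; linarith [Int.floor_le y]
  have h2 : ⌊2 * y⌋ < 2 * ⌊y⌋ + 2 := by
    rw [Int.floor_lt]; push_cast; linarith [Int.lt_floor_add_one y]
  have h3 : ∀ m : ℤ, ((m : ℤ) : ZMod 2) = c ↔ m % 2 = c.val := fun m => by
    have hc : ((c.val : ℤ) : ZMod 2) = c := by simp
    have hlt : c.val < 2 := ZMod.val_lt c
    conv_lhs => rw [← hc]
    rw [ZMod.intCast_eq_intCast_iff, Int.ModEq]
    omega
  have hlt : c.val < 2 := ZMod.val_lt c
  rw [h3]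
  omega

lemma binaryDigits_agree_iff {x : ℝ} (h0 : 0 ≤ x) (h1 : x < 1) (a : Cantor) (n : ℕ) :
    (∀ k < n, binaryDigits x k = a k) ↔ ⌊2 ^ n * x⌋ = prefixValue a n := by
  induction n with
  | zero =>
    have : ⌊x⌋ = 0 := Int.floor_eq_zero_iff.2 ⟨h0, h1⟩
    simp [prefixValue, this]
  | succ n ih =>
    rw [Nat.forall_lt_succ_right, ih, prefixValue, pow_succ', mul_assoc,
      floor_two_mul_eq_iff, binaryDigits, pow_succ', mul_assoc]

lemma prefixValue_bounds (a : Cantor) (n : ℕ) :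
    0 ≤ prefixValue a n ∧ prefixValue a n + 1 ≤ 2 ^ n := by
  induction n with
  | zero => simp [prefixValue]
  | succ n ih =>
    have hlt : (a n).val < 2 := ZMod.val_lt _
    rw [prefixValue, pow_succ]
    omega

lemma cylinder_eq_setOf_agree (a : Cantor) (n : ℕ) :
    PiNat.cylinder a n = {x : Cantor | ∀ k ∈ Finset.range n, x k = a k} := by
  ext x; simp [PiNat.mem_cylinder_iff]

lemma generateFrom_cylinders :
    (inferInstance : MeasurableSpace Cantor) =
      MeasurableSpace.generateFrom {s | ∃ (x : Cantor) (n : ℕ), s = PiNat.cylinder x n} :=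
  (PiNat.isTopologicalBasis_cylinders fun _ => ZMod 2).borel_eq_generateFrom

lemma measurable_binaryDigits : Measurable binaryDigits := by
  suffices h : Measurable[_, MeasurableSpace.generateFrom
      {s | ∃ (x : Cantor) (n : ℕ), s = PiNat.cylinder x n}] binaryDigits by
    rwa [← generateFrom_cylinders] at h
  refine measurable_generateFrom ?_
  rintro _ ⟨a, n, rfl⟩
  rw [cylinder_eq_setOf_agree]
  have hpre : binaryDigits ⁻¹' {x : Cantor | ∀ k ∈ Finset.range n, x k = a k} =
      ⋂ k ∈ Finset.range n, {x | binaryDigits x k = a k} := by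
    ext x; simp
  rw [hpre]
  refine Finset.measurableSet_biInter _ fun k _ => ?_
  have hm : Measurable fun x : ℝ => ⌊2 ^ (k + 1) * x⌋ :=
    Int.measurable_floor.comp (measurable_const_mul _)
  exact hm (MeasurableSet.of_discrete (s := {m : ℤ | (m : ZMod 2) = a k}))

lemma volume_restrict_binaryDigits_cylinder (a : Cantor) (n : ℕ) :
    volume.restrict (Ico (0 : ℝ) 1) (binaryDigits ⁻¹' PiNat.cylinder a n) = (2 ^ n)⁻¹ := by
  rw [Measure.restrict_apply' measurableSet_Ico]
  have h2 : (0 : ℝ) < 2 ^ n := by positivity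
  obtain ⟨hb0, hb1⟩ := prefixValue_bounds a n
  have hb0' : (0 : ℝ) ≤ prefixValue a n := by exact_mod_cast hb0
  have hb1' : (prefixValue a n : ℝ) + 1 ≤ 2 ^ n := by exact_mod_cast hb1
  have : binaryDigits ⁻¹' PiNat.cylinder a n ∩ Ico 0 1 =
      Ico ((prefixValue a n : ℝ) / 2 ^ n) ((prefixValue a n + 1) / 2 ^ n) := by
    ext x
    have key : x ∈ Ico ((prefixValue a n : ℝ) / 2 ^ n) ((prefixValue a n + 1) / 2 ^ n) ↔
        ⌊2 ^ n * x⌋ = prefixValue a n := by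
      rw [mem_Ico, div_le_iff₀' h2, lt_div_iff₀' h2, Int.floor_eq_iff]
    have key' : x ∈ Ico ((prefixValue a n : ℝ) / 2 ^ n) ((prefixValue a n + 1) / 2 ^ n) →
        0 ≤ x ∧ x < 1 := fun hx =>
      ⟨le_trans (by positivity) hx.1, hx.2.trans_le ((div_le_one h2).2 hb1')⟩
    simp only [mem_inter_iff, mem_preimage, PiNat.mem_cylinder_iff]
    constructor
    · rintro ⟨hx, h0, h1⟩
      exact key.2 ((binaryDigits_agree_iff h0 h1 a n).1 hx)
    · intro hx
      obtain ⟨h0, h1⟩ := key' hx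
      exact ⟨(binaryDigits_agree_iff h0 h1 a n).2 (key.1 hx), h0, h1⟩
  rw [this, Real.volume_Ico, ← sub_div, add_sub_cancel_left, one_div,
    ENNReal.ofReal_inv_of_pos h2, ENNReal.ofReal_pow (by norm_num)]
  simp

lemma measurePreserving_binaryDigits :
    MeasurePreserving binaryDigits (volume.restrict (Ico (0 : ℝ) 1)) cantorMeasure := by
  have : IsProbabilityMeasure (volume.restrict (Ico (0 : ℝ) 1)) := ⟨by simp⟩
  have := Measure.isProbabilityMeasure_map (μ := volume.restrict (Ico (0 : ℝ) 1))
    measurable_binaryDigits.aemeasurable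
  refine ⟨measurable_binaryDigits, ext_of_generate_finite _ generateFrom_cylinders ?_ ?_ ?_⟩
  · rintro _ ⟨a, n, rfl⟩ _ ⟨b, m, rfl⟩ ⟨x, hxa, hxb⟩
    rw [PiNat.mem_cylinder_iff_eq] at hxa hxb
    rw [← hxa, ← hxb]
    rcases le_total n m with h | h
    · exact ⟨x, m, inter_eq_right.2 (PiNat.cylinder_anti x h)⟩
    · exact ⟨x, n, inter_eq_left.2 (PiNat.cylinder_anti x h)⟩
  · rintro _ ⟨a, n, rfl⟩
    rw [Measure.map_apply measurable_binaryDigits (PiNat.isOpen_cylinder _ a n).measurableSet,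
      volume_restrict_binaryDigits_cylinder, cylinder_eq_setOf_agree, cantorMeasure_agree,
      Finset.card_range]
  · simp

lemma injOn_binaryDigits : InjOn binaryDigits (Ico 0 1) := by
  intro x hx y hy hxy
  have hfl : ∀ n : ℕ, ⌊2 ^ n * x⌋ = ⌊2 ^ n * y⌋ := fun n => by
    rw [(binaryDigits_agree_iff hx.1 hx.2 (binaryDigits y) n).1 fun k _ => by rw [hxy],
      (binaryDigits_agree_iff hy.1 hy.2 (binaryDigits y) n).1 fun _ _ => rfl]
  by_contra hne
  have hpos : 0 < |x - y| := abs_pos.2 (sub_ne_zero.2 hne)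
  obtain ⟨n, hn⟩ := pow_unbounded_of_one_lt (|x - y|⁻¹) (one_lt_two (α := ℝ))
  have h1 := Int.abs_sub_lt_one_of_floor_eq_floor (hfl n)
  rw [← mul_sub, abs_mul, abs_of_pos (by positivity : (0 : ℝ) < 2 ^ n)] at h1
  rw [inv_lt_iff_one_lt_mul₀ hpos] at hn
  linarith

lemma exists_measurable_leftInverse :
    ∃ ψ : Cantor → ℝ, Measurable ψ ∧ ∀ x ∈ Ico (0 : ℝ) 1, ψ (binaryDigits x) = x := by
  have : StandardBorelSpace (Ico (0 : ℝ) 1) := measurableSet_Ico.standardBorel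
  have he : MeasurableEmbedding fun x : Ico (0 : ℝ) 1 => binaryDigits x :=
    (measurable_binaryDigits.comp measurable_subtype_coe).measurableEmbedding
      fun x y h => Subtype.ext (injOn_binaryDigits x.2 y.2 h)
  obtain ⟨ψ, hψ, h⟩ := he.exists_measurable_extend measurable_subtype_coe fun _ => ⟨(0 : ℝ)⟩
  exact ⟨ψ, hψ, fun x hx => congrFun h ⟨x, hx⟩⟩

lemma measurePreserving_of_leftInverse {ψ : Cantor → ℝ} (hψ : Measurable ψ)
    (h : ∀ x ∈ Ico (0 : ℝ) 1, ψ (binaryDigits x) = x) :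
    MeasurePreserving ψ cantorMeasure (volume.restrict (Ico (0 : ℝ) 1)) := by
  refine ⟨hψ, ?_⟩
  rw [← measurePreserving_binaryDigits.map_eq, Measure.map_map hψ measurable_binaryDigits]
  have : ψ ∘ binaryDigits =ᵐ[volume.restrict (Ico (0 : ℝ) 1)] id :=
    (ae_restrict_iff' measurableSet_Ico).2 (ae_of_all _ h)
  rw [Measure.map_congr this, Measure.map_id]

lemma exists_borel_family :
    ∃ f : (ℕ → ℕ) → ℝ → ℝ, (∀ t, Measurable (f t)) ∧
      ∀ H : Set (ℝ × ℝ), volume H = 0 → ∃ bad : List ℕ → Set ℕ,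
        (∀ l, ∀ I : Finset ℕ, (I : Set ℕ) ⊆ bad l → I.card ≤ 8 ^ l.length) ∧
        ∀ t : ℕ → ℕ, (∀ᶠ n in atTop, t n ∉ bad ((List.range n).map t)) →
          volume {x | x ∈ Ico (0 : ℝ) 1 ∧ (x, f t x) ∈ H} = 0 := by
  obtain ⟨ψ, hψ, hinv⟩ := exists_measurable_leftInverse
  refine ⟨fun t x => ψ (select t (binaryDigits x)), fun t =>
    hψ.comp ((continuous_select t).measurable.comp measurable_binaryDigits), fun H hH => ?_⟩
  have hmp := measurePreserving_of_leftInverse hψ hinv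
  have hprod := hmp.prod hmp
  have hN : cantorSq (Prod.map ψ ψ ⁻¹' H) = 0 := by
    refine hprod.quasiMeasurePreserving.preimage_null ?_
    rw [Measure.prod_restrict, ← Measure.volume_eq_prod]
    exact Measure.absolutelyContinuous_of_le Measure.restrict_le_self hH
  obtain ⟨bad, hcard, hbad⟩ := exists_bad_of_null _ hN
  refine ⟨bad, hcard, fun t ht => ?_⟩
  have := measurePreserving_binaryDigits.quasiMeasurePreserving.preimage_null (hbad t ht)
  rw [Measure.restrict_apply' measurableSet_Ico] at this
  refine measure_mono_null ?_ this
  rintro x ⟨hx, hxH⟩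
  refine ⟨?_, hx⟩
  simpa [hinv x hx] using hxH

/-- Start of the `n`-th block of coordinates: it consists of `h` segments of length `h + n`,
where `h = 8 ^ n * 2 ^ blockStart n`. -/
def blockStart : ℕ → ℕ
  | 0 => 0
  | n + 1 => blockStart n +
      8 ^ n * 2 ^ blockStart n * (8 ^ n * 2 ^ blockStart n + n)

/-- The number of segments in the `n`-th block. -/
def blockCount (n : ℕ) : ℕ := 8 ^ n * 2 ^ blockStart n

/-- The `j`-th segment of the `n`-th block. -/
def blockSegment (n j : ℕ) : Finset ℕ :=
  Finset.Ico (blockStart n + j * (blockCount n + n)) (blockStart n + (j + 1) * (blockCount n + n))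

/-- A code for the restriction of `t` to the first `n + 1` blocks. -/
def blockCode (t : Cantor) (n : ℕ) : ℕ :=
  Encodable.encode ((List.range (blockStart (n + 1))).map fun k => (t k).val)

/-- The sequences vanishing on some segment of infinitely many blocks. -/
def vanishingSet : Set Cantor :=
  limsup (fun n => ⋃ j ∈ Finset.range (blockCount n),
    {x : Cantor | ∀ k ∈ blockSegment n j, x k = 0})
    atTop

lemma blockCount_pos (n : ℕ) : 0 < blockCount n := by
  unfold blockCount; positivity

lemma blockStart_succ (n : ℕ) :
    blockStart (n + 1) = blockStart n + blockCount n * (blockCount n + n) := rfl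

lemma strictMono_blockStart : StrictMono blockStart := by
  refine strictMono_nat_of_lt_succ fun n => ?_
  rw [blockStart_succ]
  have := blockCount_pos n
  exact Nat.lt_add_of_pos_right (by positivity)

lemma blockCode_eq_iff (t u : Cantor) (n : ℕ) :
    blockCode t n = blockCode u n ↔ ∀ k < blockStart (n + 1), t k = u k := by
  rw [blockCode, blockCode, Encodable.encode_inj, List.map_inj_left]
  simp only [List.mem_range]
  exact forall₂_congr fun k _ => (ZMod.val_injective 2).eq_iff

lemma cantorMeasure_vanishingSet : cantorMeasure vanishingSet = 0 := by
  refine measure_limsup_atTop_eq_zero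
    (ne_top_of_le_ne_top (b := ∑' n : ℕ, (2⁻¹ : ENNReal) ^ n) ?_ (ENNReal.tsum_le_tsum fun n => ?_))
  · rw [ENNReal.tsum_geometric, ENNReal.one_sub_inv_two, inv_inv]
    simp
  · refine (measure_biUnion_finset_le _ _).trans ?_
    have hseg : ∀ j, cantorMeasure {x : Cantor | ∀ k ∈ blockSegment n j, x k = 0} =
        (2 ^ (blockCount n + n))⁻¹ := fun j => by
      refine (cantorMeasure_agree (blockSegment n j) 0).trans ?_
      congr 2
      rw [blockSegment, Nat.card_Ico, add_mul, one_mul, ← add_assoc, Nat.add_sub_cancel_left]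
    simp_rw [hseg]
    have hle : (blockCount n : ENNReal) * (2 ^ blockCount n)⁻¹ ≤ 1 := by
      rw [← div_eq_mul_inv]
      refine ENNReal.div_le_of_le_mul ?_
      rw [one_mul]
      exact_mod_cast Nat.lt_two_pow_self.le
    rw [Finset.sum_const, Finset.card_range, nsmul_eq_mul, pow_add,
      ENNReal.mul_inv (by simp) (by simp), ← mul_assoc, ← ENNReal.inv_pow (n := n)]
    exact (mul_le_mul_left hle _).trans_eq (one_mul _)

lemma finite_of_card_le {s : Set ℕ} {m : ℕ}
    (h : ∀ I : Finset ℕ, (I : Set ℕ) ⊆ s → I.card ≤ m) : s.Finite := by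
  by_contra hs
  obtain ⟨I, hI, hc⟩ := Set.Infinite.exists_subset_card_eq hs (m + 1)
  have := h I hI
  omega

lemma exists_blockCode_cover (bad : List ℕ → Set ℕ)
    (hbad : ∀ l, ∀ I : Finset ℕ, (I : Set ℕ) ⊆ bad l → I.card ≤ 8 ^ l.length) (n : ℕ) :
    ∃ u : ℕ → Cantor, ∀ t : Cantor, blockCode t n ∈ bad ((List.range n).map (blockCode t)) →
      ∃ j < blockCount n, ∀ k < blockStart (n + 1), t k = u j k := by
  classical
  let ext : (Fin (blockStart n) → ZMod 2) → Cantor := fun v k =>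
    if h : k < blockStart n then v ⟨k, h⟩ else 0
  let pre : (Fin (blockStart n) → ZMod 2) → List ℕ := fun v =>
    (List.range n).map (blockCode (ext v))
  have hfin : ∀ v, (bad (pre v)).Finite := fun v => finite_of_card_le (hbad _)
  let V : Finset ℕ := Finset.univ.biUnion fun v => (hfin v).toFinset
  have hV : V.card ≤ blockCount n := by
    refine (Finset.card_biUnion_le_card_mul _ _ (8 ^ n) fun v _ => ?_).trans ?_
    · refine (hbad (pre v) _ (by simp)).trans (by simp [pre])
    · simp [blockCount, mul_comm]
  have hrep : ∀ i : ℕ, ∃ u : Cantor, (∃ t, blockCode t n = i) → blockCode u n = i := fun i => by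
    by_cases h : ∃ t, blockCode t n = i
    · exact ⟨h.choose, fun _ => h.choose_spec⟩
    · exact ⟨0, fun h' => absurd h' h⟩
  choose rep hrep using hrep
  refine ⟨fun j => rep (V.toList.getD j 0), fun t ht => ?_⟩
  have hmem : blockCode t n ∈ V := by
    refine Finset.mem_biUnion.2 ⟨fun k => t k, Finset.mem_univ _, ?_⟩
    rw [Set.Finite.mem_toFinset]
    convert ht using 2
    refine List.map_congr_left fun m hm => ?_
    rw [blockCode_eq_iff]
    intro k hk
    have : k < blockStart n :=
      hk.trans_le (strictMono_blockStart.monotone (List.mem_range.1 hm))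
    simp [ext, this]
  obtain ⟨j, hj, hjt⟩ := List.getElem_of_mem (Finset.mem_toList.2 hmem)
  refine ⟨j, ?_, ?_⟩
  · rw [Finset.length_toList] at hj
    exact hj.trans_le hV
  · rw [← blockCode_eq_iff]
    simp only [List.getD_eq_getElem _ _ hj, hjt]
    exact (hrep _ ⟨t, rfl⟩).symm

lemma exists_translate (bad : List ℕ → Set ℕ)
    (hbad : ∀ l, ∀ I : Finset ℕ, (I : Set ℕ) ⊆ bad l → I.card ≤ 8 ^ l.length) :
    ∃ x : Cantor, ∀ t : Cantor, t - x ∉ vanishingSet →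
      ∀ᶠ n in atTop, blockCode t n ∉ bad ((List.range n).map (blockCode t)) := by
  choose u hu using exists_blockCode_cover bad hbad
  let block : ℕ → ℕ := fun k => Nat.findGreatest (fun n => blockStart n ≤ k) k
  let x : Cantor := fun k =>
    u (block k) ((k - blockStart (block k)) / (blockCount (block k) + block k)) k
  have hseg : ∀ n, ∀ j < blockCount n, ∀ k ∈ blockSegment n j,
      k < blockStart (n + 1) ∧ x k = u n j k := by
    intro n j hj k hk
    obtain ⟨hk1, hk2⟩ := Finset.mem_Ico.1 hk
    have hlt : k < blockStart (n + 1) := by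
      refine hk2.trans_le ?_
      rw [blockStart_succ]
      gcongr
      omega
    refine ⟨hlt, ?_⟩
    have hle : blockStart n ≤ k := le_trans (Nat.le_add_right _ _) hk1
    have hblock : block k = n := by
      refine Nat.findGreatest_eq_iff.2
        ⟨(strictMono_blockStart.le_apply).trans hle, fun _ => hle, fun m hm _ => ?_⟩
      have := strictMono_blockStart.monotone (Nat.succ_le_of_lt hm)
      simp only [Nat.succ_eq_add_one] at this
      omega
    have hdiv : (k - blockStart n) / (blockCount n + n) = j := by
      refine Nat.div_eq_of_lt_le ?_ ?_ <;> omega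
    simp only [x, hblock, hdiv]
  refine ⟨x, fun t ht => ?_⟩
  rw [vanishingSet, mem_limsup_iff_frequently_mem, not_frequently] at ht
  filter_upwards [ht] with n hn hmem
  obtain ⟨j, hj, hagree⟩ := hu n t hmem
  refine hn (mem_iUnion₂.2 ⟨j, Finset.mem_range.2 hj, fun k hk => ?_⟩)
  obtain ⟨hlt, hx⟩ := hseg n j hj k hk
  rw [Pi.sub_apply, hx, hagree k hlt, sub_self]

lemma exists_branch (g : ℕ → ℕ) :
    ∃ t : ℕ → ℕ, ∀ n, t n = g (Encodable.encode ((List.range n).map t)) := by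
  let L : ℕ → List ℕ := fun n => n.rec [] fun _ l => l ++ [g (Encodable.encode l)]
  have hL : ∀ n, L n = (List.range n).map fun m => g (Encodable.encode (L m)) := fun n => by
    induction n with
    | zero => rfl
    | succ n ih =>
      rw [List.range_succ, List.map_append, ← ih]
      rfl
  exact ⟨fun n => g (Encodable.encode (L n)), fun n => by rw [← hL]⟩

lemma exists_bound (bad : List ℕ → Set ℕ)
    (hbad : ∀ l, ∀ I : Finset ℕ, (I : Set ℕ) ⊆ bad l → I.card ≤ 8 ^ l.length) :
    ∃ b : ℕ → ℕ, ∀ l, ∀ i ∈ bad l, i < b (Encodable.encode l) := by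
  have h : ∀ l, ∃ m, ∀ i ∈ bad l, i < m := fun l => by
    obtain ⟨m, hm⟩ := (finite_of_card_le (hbad l)).bddAbove
    exact ⟨m + 1, fun i hi => Nat.lt_succ_of_le (hm hi)⟩
  choose m hm using h
  refine ⟨fun c => m ((Encodable.decode c).getD []), fun l i hi => ?_⟩
  simpa using hm l i hi

lemma volume_graph_eq_zero {f : ℝ → ℝ} (hf : Measurable f) :
    volume {p : ℝ × ℝ | p.2 = f p.1} = 0 := by
  have hm : MeasurableSet {p : ℝ × ℝ | p.2 = f p.1} :=
    measurableSet_eq_fun measurable_snd (hf.comp measurable_fst)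
  rw [Measure.volume_eq_prod, Measure.measure_prod_null hm]
  refine ae_of_all _ fun x => ?_
  simp

lemma exists_family_mk_eq_covStarN :
    ∃ A : Set (Set (ℝ × ℝ)), #A = covStarN ∧ (∀ H ∈ A, volume H = 0) ∧
      ∀ f : ℝ → ℝ, Measurable f → ∀ B : Set ℝ, MeasurableSet B → 0 < volume B →
        ∃ H ∈ A, volume {x | x ∈ B ∧ (x, f x) ∈ H} ≠ 0 := by
  refine csInf_mem (s := { c : Cardinal | ∃ A : Set (Set (ℝ × ℝ)), #A = c ∧
    (∀ H ∈ A, volume H = 0) ∧ ∀ f : ℝ → ℝ, Measurable f → ∀ B : Set ℝ, MeasurableSet B →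
      0 < volume B → ∃ H ∈ A, volume {x | x ∈ B ∧ (x, f x) ∈ H} ≠ 0 })
    ⟨_, {H | volume H = 0}, rfl, fun H hH => hH, fun f hf B _ hB =>
      ⟨_, volume_graph_eq_zero hf, ?_⟩⟩
  simpa using hB.ne'

/-- `cov*(𝒩) ≥ max {𝔟, non(𝒮ℳ)}`. -/
theorem covStarN_ge_max : max frakb nonSM ≤ covStarN := by
  obtain ⟨A, hA, hnull, hcov⟩ := exists_family_mk_eq_covStarN
  obtain ⟨f, hf, hfam⟩ := exists_borel_family
  choose bad hcard hbad using fun H : A => hfam H (hnull H H.2)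
  have hcontra : ∀ t : ℕ → ℕ,
      ¬ ∀ H : A, ∀ᶠ n in atTop, t n ∉ bad H ((List.range n).map t) := fun t ht => by
    obtain ⟨H, hH, hne⟩ := hcov (f t) (hf t) (Ico 0 1) measurableSet_Ico (by simp)
    exact hne (hbad ⟨H, hH⟩ t (ht ⟨H, hH⟩))
  rw [← hA]
  refine max_le ?_ ?_
  · choose b hb using fun H : A => exists_bound (bad H) (hcard H)
    suffices h : ∀ g : ℕ → ℕ, ∃ φ ∈ range b, ¬ ∀ᶠ n in atTop, φ n ≤ g n by
      have hle : frakb ≤ #(range b) := csInf_le' ⟨range b, rfl, h⟩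
      exact hle.trans mk_range_le
    intro g
    by_contra! hg
    obtain ⟨t, ht⟩ := exists_branch g
    refine hcontra t fun H => ?_
    have hinj : Function.Injective fun n => Encodable.encode ((List.range n).map t) := by
      intro n m h
      simpa using congrArg List.length (Encodable.encode_injective h)
    have htend := hinj.nat_tendsto_atTop
    filter_upwards [htend.eventually (hg _ ⟨H, rfl⟩)] with n hn hmem
    have h1 := hb H _ _ hmem
    rw [← ht n] at hn
    omega
  · choose x hx using fun H : A => exists_translate (bad H) (hcard H)
    suffices h : ¬ StronglyMeager (range x) by
      have hle : nonSM ≤ #(range x) := csInf_le' ⟨range x, rfl, h⟩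
      exact hle.trans mk_range_le
    intro hsm
    obtain ⟨t, ht⟩ := (ne_univ_iff_exists_notMem _).1 (hsm _ cantorMeasure_vanishingSet)
    refine hcontra (blockCode t) fun H => hx H t fun hmem => ht ?_
    exact ⟨x H, ⟨H, rfl⟩, t - x H, hmem, add_sub_cancel _ _⟩
end

section
/- non*(𝒩) ≤ min{𝔡, non(𝒮𝒩)}. -/
open Cardinal MeasureTheory Set Filter Pointwise

/-- `non*(𝒩)`: the least cardinality of a family `X` of Borel functions `f : ℝ → ℝ` such that
for every null `H ⊆ ℝ × ℝ` and every Borel set `B ⊆ ℝ` of positive Lebesgue measure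
there is `f ∈ X` with `{x ∈ B : (x, f x) ∉ H}` not Lebesgue-null. -/
noncomputable def nonStarN : Cardinal :=
  sInf { c : Cardinal | ∃ X : Set (ℝ → ℝ), #X = c ∧ (∀ f ∈ X, Measurable f) ∧
    ∀ H : Set (ℝ × ℝ), volume H = 0 → ∀ B : Set ℝ, MeasurableSet B → 0 < volume B →
      ∃ f ∈ X, volume {x | x ∈ B ∧ (x, f x) ∉ H} ≠ 0 }

/-- The dominating number `𝔡`. -/
noncomputable def frakd : Cardinal :=
  sInf { c : Cardinal | ∃ F : Set (ℕ → ℕ), #F = c ∧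
    ∀ g : ℕ → ℕ, ∃ f ∈ F, ∀ᶠ n in atTop, g n ≤ f n }

/-- `X ⊆ 2^ω` has strong measure zero iff `X + F ≠ 2^ω` for every meager `F`. -/
def HasStrongMeasureZero (X : Set Cantor) : Prop :=
  ∀ F : Set Cantor, IsMeagre F → X + F ≠ Set.univ

/-- `non(𝒮𝒩)`: the least cardinality of a subset of `2^ω` that does not have
strong measure zero. -/
noncomputable def nonSN : Cardinal :=
  sInf { c : Cardinal | ∃ X : Set Cantor, #X = c ∧ ¬ HasStrongMeasureZero X }


/-- The `n`-th Rademacher function on `ℝ`. -/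
noncomputable def rademacher (n : ℕ) (x : ℝ) : ℝ :=
  if Int.fract (2 ^ n * x) < 1 / 2 then 1 else -1

/-- The involution of `ℝ` that changes the `n`-th binary digit after the point. -/
noncomputable def flipDigit (n : ℕ) (x : ℝ) : ℝ := x + rademacher n x / 2 ^ (n + 1)

theorem rademacher_eq_or (n : ℕ) (x : ℝ) : rademacher n x = 1 ∨ rademacher n x = -1 := by
  unfold rademacher
  split_ifs <;> simp

theorem abs_rademacher (n : ℕ) (x : ℝ) : |rademacher n x| = 1 := by
  rcases rademacher_eq_or n x with h | h <;> simp [h]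

theorem rademacher_mul_self (n : ℕ) (x : ℝ) : rademacher n x * rademacher n x = 1 := by
  rcases rademacher_eq_or n x with h | h <;> simp [h]

@[fun_prop]
theorem measurable_rademacher (n : ℕ) : Measurable (rademacher n) := by
  refine Measurable.ite ?_ measurable_const measurable_const
  exact measurableSet_lt (by fun_prop) measurable_const

@[fun_prop]
theorem measurable_flipDigit (n : ℕ) : Measurable (flipDigit n) := by
  unfold flipDigit
  fun_prop

theorem rademacher_add_half (n : ℕ) (x : ℝ) :
    rademacher n (x + 1 / 2 ^ (n + 1)) = -rademacher n x := by
  have h : (2 : ℝ) ^ n * (x + 1 / 2 ^ (n + 1)) = 2 ^ n * x + 1 / 2 := by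
    field_simp
    ring
  unfold rademacher
  rw [h]
  set t := (2 : ℝ) ^ n * x
  have h0 := Int.fract_nonneg t
  have h1 := Int.fract_lt_one t
  have ht := Int.self_sub_floor t
  split_ifs with h2 h3 h3
  · have : Int.fract (t + 1 / 2) = Int.fract t + 1 / 2 :=
      Int.fract_eq_iff.2 ⟨by linarith, by linarith, ⌊t⌋, by linarith⟩
    linarith
  · simp
  · simp
  · have : Int.fract (t + 1 / 2) = Int.fract t - 1 / 2 :=
      Int.fract_eq_iff.2 ⟨by linarith, by linarith, ⌊t⌋ + 1, by push_cast; linarith⟩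
    linarith

theorem rademacher_add_of_lt {i j : ℕ} (hij : i < j) (x : ℝ) :
    rademacher j (x + 1 / 2 ^ (i + 1)) = rademacher j x := by
  have h : (2 : ℝ) ^ j * (x + 1 / 2 ^ (i + 1)) = 2 ^ j * x + ((2 ^ (j - (i + 1)) : ℕ) : ℝ) := by
    push_cast
    rw [mul_add, pow_sub₀ _ two_ne_zero (Nat.succ_le_of_lt hij), Nat.succ_eq_add_one]
    field_simp
  unfold rademacher
  rw [h, Int.fract_add_natCast]

theorem rademacher_periodic (n : ℕ) : Function.Periodic (rademacher n) 1 := by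
  intro x
  have h : (2 : ℝ) ^ n * (x + 1) = 2 ^ n * x + ((2 ^ n : ℕ) : ℝ) := by
    push_cast
    ring
  unfold rademacher
  rw [h, Int.fract_add_natCast]

theorem floor_flipDigit (n : ℕ) (x : ℝ) : ⌊2 ^ n * flipDigit n x⌋ = ⌊2 ^ n * x⌋ := by
  have h : (2 : ℝ) ^ n * flipDigit n x = 2 ^ n * x + rademacher n x / 2 := by
    unfold flipDigit
    field_simp
    ring
  rw [h]
  unfold rademacher
  have h0 := Int.fract_nonneg (2 ^ n * x)
  have h1 := Int.fract_lt_one (2 ^ n * x)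
  have ht := Int.self_sub_floor (2 ^ n * x)
  rw [Int.floor_eq_iff]
  split_ifs <;> constructor <;> linarith

theorem floor_two_pow_mul {i n : ℕ} (hi : i ≤ n) (x : ℝ) :
    ⌊2 ^ i * x⌋ = ⌊2 ^ n * x⌋ / ((2 ^ (n - i) : ℕ) : ℤ) := by
  rw [← Int.floor_div_natCast]
  congr 1
  push_cast
  rw [pow_sub₀ _ two_ne_zero hi]
  field_simp

theorem rademacher_eq_floor (i : ℕ) (x : ℝ) :
    rademacher i x = 1 - 2 * (⌊2 ^ (i + 1) * x⌋ - 2 * ⌊2 ^ i * x⌋) := by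
  have h : (2 : ℝ) ^ (i + 1) * x = 2 * (2 ^ i * x) := by ring
  rw [h]
  unfold rademacher
  set t := (2 : ℝ) ^ i * x
  have h0 := Int.fract_nonneg t
  have h1 := Int.fract_lt_one t
  have ht := Int.self_sub_floor t
  split_ifs with h2
  · have : ⌊2 * t⌋ = 2 * ⌊t⌋ := by
      rw [Int.floor_eq_iff]
      push_cast
      constructor <;> linarith
    rw [this]
    push_cast
    ring
  · have : ⌊2 * t⌋ = 2 * ⌊t⌋ + 1 := by
      rw [Int.floor_eq_iff]
      push_cast
      constructor <;> linarith
    rw [this]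
    push_cast
    ring

theorem rademacher_flipDigit_of_lt {i n : ℕ} (hi : i < n) (x : ℝ) :
    rademacher i (flipDigit n x) = rademacher i x := by
  rw [rademacher_eq_floor, rademacher_eq_floor, floor_two_pow_mul hi, floor_two_pow_mul hi.le,
    floor_flipDigit, ← floor_two_pow_mul hi, ← floor_two_pow_mul hi.le]

theorem rademacher_sub_half (n : ℕ) (x : ℝ) :
    rademacher n (x - 1 / 2 ^ (n + 1)) = -rademacher n x := by
  have := rademacher_add_half n (x - 1 / 2 ^ (n + 1))
  rw [sub_add_cancel] at this
  linarith

theorem rademacher_flipDigit_self (n : ℕ) (x : ℝ) :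
    rademacher n (flipDigit n x) = -rademacher n x := by
  unfold flipDigit
  rcases rademacher_eq_or n x with h | h
  · rw [h, rademacher_add_half, h]
  · rw [h, neg_div, ← sub_eq_add_neg, rademacher_sub_half, h]

theorem measurePreserving_flipDigit (n : ℕ) : MeasurePreserving (flipDigit n) := by
  refine ⟨measurable_flipDigit n, ?_⟩
  ext A hA
  rw [Measure.map_apply (measurable_flipDigit n) hA]
  have hD : MeasurableSet {x | rademacher n x = 1} :=
    measurable_rademacher n (measurableSet_singleton 1)
  rw [← measure_inter_add_sdiff _ hD, ← measure_inter_add_sdiff A hD, add_comm]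
  congr 1
  · rw [← measure_preimage_add_right volume (-(1 / 2 ^ (n + 1)) : ℝ)
      (A ∩ {x | rademacher n x = 1})]
    congr 1
    ext x
    simp only [Set.mem_sdiff, mem_preimage, mem_inter_iff, mem_ofPred_eq, ← sub_eq_add_neg,
      rademacher_sub_half]
    unfold flipDigit
    rcases rademacher_eq_or n x with h | h <;> norm_num [h]
    simp [neg_div, sub_eq_add_neg]
  · rw [← measure_preimage_add_right volume (1 / 2 ^ (n + 1) : ℝ)
      (A \ {x | rademacher n x = 1})]
    congr 1
    ext x
    simp only [Set.mem_sdiff, mem_preimage, mem_inter_iff, mem_ofPred_eq, rademacher_add_half]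
    unfold flipDigit
    rcases rademacher_eq_or n x with h | h <;> norm_num [h]

theorem measurePreserving_flipDigit_restrict (n : ℕ) :
    MeasurePreserving (flipDigit n) (volume.restrict (Ico (0 : ℝ) 1))
      (volume.restrict (Ico (0 : ℝ) 1)) := by
  have h : flipDigit n ⁻¹' Ico (0 : ℝ) 1 = Ico 0 1 := by
    ext x
    have : ⌊flipDigit n x⌋ = ⌊x⌋ := by
      have := floor_two_pow_mul (Nat.zero_le n) (flipDigit n x)
      rw [floor_flipDigit, ← floor_two_pow_mul (Nat.zero_le n) x] at this
      simpa using this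
    have h1 := Int.floor_eq_zero_iff (a := flipDigit n x)
    have h2 := Int.floor_eq_zero_iff (a := x)
    rw [mem_preimage, ← h1, ← h2, this]
  have := (measurePreserving_flipDigit n).restrict_preimage
    (measurableSet_Ico (a := (0 : ℝ)) (b := 1))
  rwa [h] at this

theorem integral_rademacher_mul_rademacher {i j : ℕ} (hij : i ≠ j) (k : ℤ) :
    ∫ x in Ico (k : ℝ) (k + 1), rademacher i x * rademacher j x = 0 := by
  wlog h : i < j generalizing i j
  · simp_rw [mul_comm (rademacher i _)]
    exact this hij.symm (by omega)
  rw [integral_Ico_eq_integral_Ioc, ← intervalIntegral.integral_of_le (by linarith)]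
  have hp : Function.Periodic (fun x => rademacher i x * rademacher j x) 1 :=
    (rademacher_periodic i).mul (rademacher_periodic j)
  have h1 := hp.intervalIntegral_add_eq (k : ℝ) (k + 1 / 2 ^ (i + 1))
  have h2 := intervalIntegral.integral_comp_add_right (a := (k : ℝ)) (b := k + 1)
    (fun x => rademacher i x * rademacher j x) (1 / 2 ^ (i + 1))
  simp only [rademacher_add_half, rademacher_add_of_lt h, neg_mul,
    intervalIntegral.integral_neg] at h2
  rw [add_right_comm, ← h1] at h2
  linarith

/-- `p.2` with its binary digits in positions `m ≤ i < n` replaced by the digits of `p.1` in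
positions `π i`. -/
noncomputable def spliceDigits (π : ℕ → ℕ) (m n : ℕ) (p : ℝ × ℝ) : ℝ :=
  p.2 + ∑ i ∈ Finset.Ico m n, (rademacher i p.2 - rademacher (π i) p.1) / 2 ^ (i + 2)

@[fun_prop]
theorem measurable_spliceDigits (π : ℕ → ℕ) (m n : ℕ) : Measurable (spliceDigits π m n) := by
  unfold spliceDigits
  fun_prop

/-- `p.2` with its `n`-th binary digit replaced by the `j`-th digit of `p.1`. -/
noncomputable def copyDigit (j n : ℕ) (p : ℝ × ℝ) : ℝ × ℝ :=
  (p.1, p.2 + (rademacher n p.2 - rademacher j p.1) / 2 ^ (n + 2))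

theorem copyDigit_of_eq {j n : ℕ} {p : ℝ × ℝ} (h : rademacher n p.2 = rademacher j p.1) :
    copyDigit j n p = p := by
  simp [copyDigit, h]

theorem copyDigit_of_eq_neg {j n : ℕ} {p : ℝ × ℝ} (h : rademacher n p.2 = -rademacher j p.1) :
    copyDigit j n p = (p.1, flipDigit n p.2) := by
  have : rademacher j p.1 = -rademacher n p.2 := by rw [h, neg_neg]
  simp only [copyDigit, flipDigit, this, Prod.mk.injEq, true_and]
  field_simp
  ring

theorem rademacher_eq_or_eq_neg (i j : ℕ) (x y : ℝ) :
    rademacher i x = rademacher j y ∨ rademacher i x = -rademacher j y := by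
  rcases rademacher_eq_or i x with h | h <;> rcases rademacher_eq_or j y with h' | h' <;>
    simp [h, h']

theorem spliceDigits_succ (π : ℕ → ℕ) {m n : ℕ} (h : m ≤ n) (p : ℝ × ℝ) :
    spliceDigits π m (n + 1) p = spliceDigits π m n (copyDigit (π n) n p) := by
  have h' : ∀ i ∈ Finset.Ico m n,
      (rademacher i (copyDigit (π n) n p).2 - rademacher (π i) (copyDigit (π n) n p).1) /
        2 ^ (i + 2) = (rademacher i p.2 - rademacher (π i) p.1) / 2 ^ (i + 2) := by
    intro i hi
    rcases rademacher_eq_or_eq_neg n (π n) p.2 p.1 with h | h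
    · rw [copyDigit_of_eq h]
    · rw [copyDigit_of_eq_neg h, rademacher_flipDigit_of_lt (Finset.mem_Ico.1 hi).2]
  unfold spliceDigits
  rw [Finset.sum_congr rfl h', Finset.sum_Ico_succ_top h]
  simp only [copyDigit]
  ring

/-- Lebesgue measure on the unit square `[k, k + 1) × [0, 1)`. -/
noncomputable def squareMeasure (k : ℤ) : Measure (ℝ × ℝ) :=
  (volume.restrict (Ico (k : ℝ) (k + 1))).prod (volume.restrict (Ico (0 : ℝ) 1))

instance isProbabilityMeasure_restrict_Ico (k : ℤ) :
    IsProbabilityMeasure (volume.restrict (Ico (k : ℝ) (k + 1))) :=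
  ⟨by simp⟩

instance isProbabilityMeasure_restrict_Ico_zero_one :
    IsProbabilityMeasure (volume.restrict (Ico (0 : ℝ) 1)) :=
  ⟨by simp⟩

instance isProbabilityMeasure_squareMeasure (k : ℤ) : IsProbabilityMeasure (squareMeasure k) := by
  unfold squareMeasure
  infer_instance

theorem integrable_of_abs_le {α : Type*} [MeasurableSpace α] {μ : Measure α} [IsFiniteMeasure μ]
    {f : α → ℝ} (hf : Measurable f) {C : ℝ} (hC : ∀ x, |f x| ≤ C) : Integrable f μ :=
  Integrable.of_bound hf.aestronglyMeasurable C (.of_forall hC)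

theorem integral_copyDigit (k : ℤ) (j n : ℕ) {Ψ : ℝ × ℝ → ℝ} (hΨ : Measurable Ψ)
    (hΨ1 : ∀ p, |Ψ p| ≤ 1) :
    ∫ p, Ψ (copyDigit j n p) ∂squareMeasure k = ∫ p, Ψ p ∂squareMeasure k +
      ∫ p, rademacher j p.1 * rademacher n p.2 * Ψ p ∂squareMeasure k := by
  have hφ : MeasurePreserving (fun p : ℝ × ℝ => (p.1, flipDigit n p.2))
      (squareMeasure k) (squareMeasure k) :=
    (MeasurePreserving.id _).prod (measurePreserving_flipDigit_restrict n)
  have hi : Integrable (fun p : ℝ × ℝ => rademacher j p.1 * rademacher n p.2 * Ψ p)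
      (squareMeasure k) := by
    refine integrable_of_abs_le (C := 1) (by fun_prop) fun p => ?_
    simpa [abs_mul, abs_rademacher] using hΨ1 p
  have hΨi : Integrable Ψ (squareMeasure k) := integrable_of_abs_le hΨ hΨ1
  set f : ℝ × ℝ → ℝ := fun p => Ψ p + rademacher j p.1 * rademacher n p.2 * Ψ p with hf
  have hfi : Integrable f (squareMeasure k) := hΨi.add hi
  have hfφ : ∫ p, f (p.1, flipDigit n p.2) ∂squareMeasure k = ∫ p, f p ∂squareMeasure k := by
    conv_rhs => rw [← hφ.map_eq]
    rw [integral_map hφ.measurable.aemeasurable]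
    exact (by fun_prop : Measurable f).aestronglyMeasurable
  have hfφi : Integrable (fun p : ℝ × ℝ => f (p.1, flipDigit n p.2)) (squareMeasure k) :=
    hφ.integrable_comp_of_integrable hfi
  rw [← integral_add hΨi hi]
  have : ∀ p, Ψ (copyDigit j n p) = 2⁻¹ * (f p + f (p.1, flipDigit n p.2)) := by
    intro p
    simp only [hf, rademacher_flipDigit_self]
    rcases rademacher_eq_or_eq_neg n j p.2 p.1 with h | h
    · rw [copyDigit_of_eq h, h, mul_neg, rademacher_mul_self]
      ring
    · rw [copyDigit_of_eq_neg h, h, neg_neg, mul_neg, rademacher_mul_self]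
      ring
  simp_rw [this]
  rw [integral_const_mul, integral_add hfi hfφi, hfφ]
  ring

theorem integral_rademacher_mul_rademacher_square (k : ℤ) (i j n : ℕ) :
    ∫ p : ℝ × ℝ, (rademacher i p.1 * rademacher n p.2) * (rademacher j p.1 * rademacher n p.2)
      ∂squareMeasure k = if i = j then 1 else 0 := by
  have : ∀ p : ℝ × ℝ, (rademacher i p.1 * rademacher n p.2) *
      (rademacher j p.1 * rademacher n p.2) =
        (rademacher i p.1 * rademacher j p.1) * (fun _ => (1 : ℝ)) p.2 := by
    intro p
    rw [mul_mul_mul_comm, rademacher_mul_self]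
  rw [integral_congr_ae (.of_forall this), squareMeasure,
    integral_prod_mul (fun x => rademacher i x * rademacher j x) (fun _ => (1 : ℝ))]
  split_ifs with h
  · simp [h, rademacher_mul_self]
  · rw [integral_rademacher_mul_rademacher h, zero_mul]

/-- Bessel's inequality for the orthonormal system of the functions
`(x, y) ↦ rademacher j x * rademacher n y`. -/
theorem card_mul_sq_le_one (k : ℤ) (n : ℕ) {Ψ : ℝ × ℝ → ℝ} (hΨ : Measurable Ψ)
    (hΨ1 : ∀ p, |Ψ p| ≤ 1) {ε : ℝ} (hε : 0 < ε) (F : Finset ℕ)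
    (hF : ∀ j ∈ F, ∫ p, rademacher j p.1 * rademacher n p.2 * Ψ p ∂squareMeasure k ≤ -ε) :
    (F.card : ℝ) * ε ^ 2 ≤ 1 := by
  set N : ℝ := (F.card : ℝ) with hN
  have hN0 : 0 ≤ N := by positivity
  let χ : ℕ → ℝ × ℝ → ℝ := fun j p => rademacher j p.1 * rademacher n p.2
  have hχm : ∀ j, Measurable (χ j) := fun j => by fun_prop
  have hχ1 : ∀ j p, |χ j p| ≤ 1 := fun j p => by simp [χ, abs_mul, abs_rademacher]
  have h0 : 0 ≤ ∫ p, (∑ j ∈ F, χ j p + N * ε * Ψ p) ^ 2 ∂squareMeasure k :=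
    integral_nonneg fun p => sq_nonneg _
  have hexp : ∀ p, (∑ j ∈ F, χ j p + N * ε * Ψ p) ^ 2 =
      (∑ i ∈ F, ∑ j ∈ F, χ i p * χ j p + ∑ j ∈ F, 2 * N * ε * (χ j p * Ψ p)) +
        (N * ε) ^ 2 * Ψ p ^ 2 := by
    intro p
    rw [← Finset.sum_mul_sum, ← Finset.mul_sum, ← Finset.sum_mul F (fun j => χ j p)]
    ring
  have hi1 : ∀ i j, Integrable (fun p => χ i p * χ j p) (squareMeasure k) := fun i j =>
    integrable_of_abs_le (C := 1) (by fun_prop) fun p => by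
      rw [abs_mul]
      exact mul_le_one₀ (hχ1 i p) (abs_nonneg _) (hχ1 j p)
  have hi2 : ∀ j, Integrable (fun p => χ j p * Ψ p) (squareMeasure k) := fun j =>
    integrable_of_abs_le (C := 1) (by fun_prop) fun p => by
      rw [abs_mul]
      exact mul_le_one₀ (hχ1 j p) (abs_nonneg _) (hΨ1 p)
  have hi3 : Integrable (fun p => Ψ p ^ 2) (squareMeasure k) :=
    integrable_of_abs_le (C := 1) (by fun_prop) fun p => by
      rw [abs_pow]
      exact pow_le_one₀ (abs_nonneg _) (hΨ1 p)
  simp_rw [hexp] at h0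
  rw [integral_add, integral_add, integral_finsetSum, integral_finsetSum,
    integral_const_mul] at h0
  rotate_left
  · exact fun j _ => (hi2 j).const_mul _
  · exact fun i _ => integrable_finsetSum _ fun j _ => hi1 i j
  · exact integrable_finsetSum _ fun i _ => integrable_finsetSum _ fun j _ => hi1 i j
  · exact integrable_finsetSum _ fun j _ => (hi2 j).const_mul _
  · exact (integrable_finsetSum _ fun i _ => integrable_finsetSum _ fun j _ => hi1 i j).add
      (integrable_finsetSum _ fun j _ => (hi2 j).const_mul _)
  · exact hi3.const_mul _
  have h1 : ∑ i ∈ F, ∫ p, ∑ j ∈ F, χ i p * χ j p ∂squareMeasure k = N := by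
    rw [hN, Finset.card_eq_sum_ones]
    push_cast
    refine Finset.sum_congr rfl fun i hi => ?_
    rw [integral_finsetSum _ fun j _ => hi1 i j]
    simp [χ, integral_rademacher_mul_rademacher_square, hi]
  have h2 : ∑ j ∈ F, ∫ p, 2 * N * ε * (χ j p * Ψ p) ∂squareMeasure k ≤
      N * (2 * N * ε * -ε) := by
    rw [hN, ← nsmul_eq_mul, ← hN]
    refine Finset.sum_le_card_nsmul _ _ _ fun j hj => ?_
    rw [integral_const_mul]
    exact mul_le_mul_of_nonneg_left (hF j hj) (by positivity)
  have h3 : ∫ p, Ψ p ^ 2 ∂squareMeasure k ≤ 1 := by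
    have : ∫ p, Ψ p ^ 2 ∂squareMeasure k ≤ ∫ _, (1 : ℝ) ∂squareMeasure k :=
      integral_mono hi3 (integrable_const _) fun p => by
        rw [← sq_abs]
        exact pow_le_one₀ (abs_nonneg _) (hΨ1 p)
    simpa using this
  have h4 : (N * ε) ^ 2 * ∫ p, Ψ p ^ 2 ∂squareMeasure k ≤ (N * ε) ^ 2 * 1 :=
    mul_le_mul_of_nonneg_left h3 (sq_nonneg _)
  rw [h1] at h0
  by_contra! h
  have hNpos : 0 < N := by
    rcases hN0.lt_or_eq with h' | h'
    · exact h'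
    · rw [← h'] at h
      norm_num at h
  nlinarith

theorem spliceDigits_congr {π π' : ℕ → ℕ} (m : ℕ) {n : ℕ} (h : ∀ i < n, π i = π' i) :
    spliceDigits π m n = spliceDigits π' m n := by
  ext p
  unfold spliceDigits
  congr 1
  exact Finset.sum_congr rfl fun i hi => by rw [h i (Finset.mem_Ico.1 hi).2]

/-- The `0`-`1`-valued function of the pairs that `spliceDigits π m n` moves into `K`. -/
noncomputable def spliceIndicator (K : Set (ℝ × ℝ)) (π : ℕ → ℕ) (m n : ℕ) (p : ℝ × ℝ) : ℝ :=
  K.indicator 1 (p.1, spliceDigits π m n p)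

theorem measurable_spliceIndicator {K : Set (ℝ × ℝ)} (hK : MeasurableSet K) (π : ℕ → ℕ)
    (m n : ℕ) : Measurable (spliceIndicator K π m n) :=
  (measurable_one.indicator hK).comp (by fun_prop)

theorem abs_spliceIndicator_le (K : Set (ℝ × ℝ)) (π : ℕ → ℕ) (m n : ℕ) (p : ℝ × ℝ) :
    |spliceIndicator K π m n p| ≤ 1 := by
  unfold spliceIndicator indicator
  split_ifs <;> simp

/-- Given that the digits in positions `m ≤ i < s.length` are copied according to `s`, the
positions from which the next digit should not be copied. -/
noncomputable def badPositions (K : Set (ℝ × ℝ)) (k : ℤ) (s : List ℕ) (m : ℕ) : Set ℕ :=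
  {j | ∫ p, rademacher j p.1 * rademacher s.length p.2 *
    spliceIndicator K (fun i => s.getD i 0) m s.length p ∂squareMeasure k <
      -(1 / 2) ^ s.length}

theorem card_le_of_subset_badPositions {K : Set (ℝ × ℝ)} (hK : MeasurableSet K) (k : ℤ)
    (s : List ℕ) (m : ℕ) (F : Finset ℕ) (hF : ↑F ⊆ badPositions K k s m) :
    F.card ≤ 4 ^ s.length := by
  have h := card_mul_sq_le_one k s.length
    (measurable_spliceIndicator hK (fun i => s.getD i 0) m s.length)
    (abs_spliceIndicator_le K _ m s.length) (ε := (1 / 2) ^ s.length) (by positivity) F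
    fun j hj => (hF hj).le
  rw [← pow_mul, mul_comm s.length, pow_mul, one_div, inv_pow, inv_pow] at h
  have h4 : (0 : ℝ) < 4 ^ s.length := by positivity
  norm_num at h
  rw [← div_eq_mul_inv, div_le_one h4] at h
  exact_mod_cast h

theorem finite_badPositions {K : Set (ℝ × ℝ)} (hK : MeasurableSet K) (k : ℤ)
    (s : List ℕ) (m : ℕ) : (badPositions K k s m).Finite := by
  by_contra h
  obtain ⟨F, hF, hc⟩ := Set.Infinite.exists_subset_card_eq h (4 ^ s.length + 1)
  have := card_le_of_subset_badPositions hK k s m F hF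
  omega

theorem integral_spliceIndicator_ge {K : Set (ℝ × ℝ)} (hK : MeasurableSet K) (k : ℤ)
    {π : ℕ → ℕ} {m : ℕ} (hπ : ∀ n ≥ m, π n ∉ badPositions K k ((List.range n).map π) m)
    {n : ℕ} (hn : m ≤ n) :
    (squareMeasure k).real K - 2 * (1 / 2) ^ m + 2 * (1 / 2) ^ n ≤
      ∫ p, spliceIndicator K π m n p ∂squareMeasure k := by
  induction n, hn using Nat.le_induction with
  | base =>
    have : spliceIndicator K π m m = K.indicator 1 := by
      ext p
      simp [spliceIndicator, spliceDigits]
    rw [this, integral_indicator_one hK]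
    linarith
  | succ n hn ih =>
    have hsplice : spliceDigits (fun i => ((List.range n).map π).getD i 0) m n =
        spliceDigits π m n := by
      refine spliceDigits_congr m fun i hi => ?_
      simp [hi]
    have h := hπ n hn
    simp only [badPositions, mem_ofPred_eq, not_lt, List.length_map, List.length_range,
      spliceIndicator, hsplice] at h
    have h2 : ∀ p, spliceIndicator K π m (n + 1) p =
        spliceIndicator K π m n (copyDigit (π n) n p) := by
      intro p
      simp [spliceIndicator, spliceDigits_succ π hn, copyDigit]
    simp_rw [h2]
    rw [integral_copyDigit k (π n) n (measurable_spliceIndicator hK π m n)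
      (abs_spliceIndicator_le K π m n)]
    simp only [spliceIndicator] at ih ⊢
    rw [pow_succ]
    linarith

/-- The sum of a series of Rademacher functions, with order given by `π`. It is a translate of the
map that sends `x` to the number whose `i`-th binary digit is the `π i`-th digit of `x`. -/
noncomputable def rademacherSeries (π : ℕ → ℕ) (x : ℝ) : ℝ :=
  -∑' i, rademacher (π i) x / 2 ^ (i + 2)

theorem summable_rademacher (π : ℕ → ℕ) (x : ℝ) :
    Summable fun i => rademacher (π i) x / 2 ^ (i + 2) := by
  refine Summable.of_norm_bounded (g := fun i : ℕ => (1 / 2 : ℝ) ^ i)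
    (summable_geometric_of_lt_one (by norm_num) (by norm_num)) fun i => ?_
  rw [Real.norm_eq_abs, abs_div, abs_rademacher, abs_of_pos (by positivity), one_div_pow]
  exact one_div_le_one_div_of_le (by positivity)
    (pow_le_pow_right₀ (by norm_num) (Nat.le_add_right _ _))

theorem measurable_rademacherSeries (π : ℕ → ℕ) : Measurable (rademacherSeries π) := by
  refine (measurable_of_tendsto_metrizable
    (f := fun n x => ∑ i ∈ Finset.range n, rademacher (π i) x / 2 ^ (i + 2)) (fun n => ?_)
    (tendsto_pi_nhds.2 fun x => (summable_rademacher π x).hasSum.tendsto_sum_nat)).neg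
  fun_prop

theorem add_sum_rademacher (y : ℝ) (n : ℕ) :
    y + ∑ i ∈ Finset.range n, rademacher i y / 2 ^ (i + 2) =
      ⌊y⌋ + 1 / 2 - (1 / 2) * (1 / 2) ^ n + Int.fract (2 ^ n * y) * (1 / 2) ^ n := by
  induction n with
  | zero => simp
  | succ n ih =>
    rw [Finset.sum_range_succ, ← add_assoc, ih, rademacher_eq_floor, ← Int.self_sub_floor,
      ← Int.self_sub_floor, one_div_pow, one_div_pow]
    field_simp
    ring

theorem tendsto_add_sum_rademacher (y : ℝ) :
    Tendsto (fun n => y + ∑ i ∈ Finset.range n, rademacher i y / 2 ^ (i + 2)) atTop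
      (nhds (⌊y⌋ + 1 / 2)) := by
  simp_rw [add_sum_rademacher]
  have h := tendsto_pow_atTop_nhds_zero_of_lt_one (r := (1 / 2 : ℝ)) (by norm_num) (by norm_num)
  have h0 := h.const_mul (1 / 2)
  have h1 : Tendsto (fun n => Int.fract (2 ^ n * y) * (1 / 2 : ℝ) ^ n) atTop (nhds 0) := by
    refine squeeze_zero (fun n => mul_nonneg (Int.fract_nonneg _) (by positivity))
      (fun n => ?_) h
    exact mul_le_of_le_one_left (by positivity) (Int.fract_lt_one _).le
  have h2 := ((tendsto_const_nhds (x := (⌊y⌋ + 1 / 2 : ℝ))).sub h0).add h1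
  rwa [mul_zero, sub_zero, add_zero] at h2

/-- The sequence `spliceDigits π m n p` converges, and its limit differs from
`rademacherSeries π p.1` by a rational number. -/
theorem exists_rat_tendsto_spliceDigits (π : ℕ → ℕ) (m : ℕ) (p : ℝ × ℝ) :
    ∃ q : ℚ, Tendsto (fun n => spliceDigits π m n p) atTop
      (nhds (rademacherSeries π p.1 + q)) := by
  obtain ⟨q, hq⟩ : (⌊p.2⌋ + 1 / 2 + ∑ i ∈ Finset.range m,
      (rademacher (π i) p.1 - rademacher i p.2) / 2 ^ (i + 2) : ℝ) ∈
        (Rat.castHom ℝ).fieldRange := by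
    have hr : ∀ i x, rademacher i x ∈ (Rat.castHom ℝ).fieldRange := by
      intro i x
      rcases rademacher_eq_or i x with h | h <;> rw [h]
      · exact one_mem _
      · exact neg_mem (one_mem _)
    have h2 : (2 : ℝ) ∈ (Rat.castHom ℝ).fieldRange := ofNat_mem _ 2
    exact add_mem (add_mem (intCast_mem _ _) (div_mem (one_mem _) h2))
      (sum_mem fun i _ => div_mem (sub_mem (hr _ _) (hr _ _)) (pow_mem h2 _))
  refine ⟨q, ?_⟩
  replace hq : (q : ℝ) = _ := hq
  have h := ((tendsto_add_sum_rademacher p.2).sub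
    (summable_rademacher π p.1).hasSum.tendsto_sum_nat).add_const
      (∑ i ∈ Finset.range m, (rademacher (π i) p.1 - rademacher i p.2) / 2 ^ (i + 2))
  have hlim : rademacherSeries π p.1 + q = (⌊p.2⌋ + 1 / 2 : ℝ) -
      ∑' i, rademacher (π i) p.1 / 2 ^ (i + 2) +
        ∑ i ∈ Finset.range m, (rademacher (π i) p.1 - rademacher i p.2) / 2 ^ (i + 2) := by
    rw [hq, rademacherSeries]
    ring
  rw [hlim]
  refine h.congr' ?_
  filter_upwards [eventually_ge_atTop m] with n hn
  rw [spliceDigits, Finset.sum_Ico_eq_sub _ hn]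
  simp only [sub_div, Finset.sum_sub_distrib]
  ring

theorem squareMeasure_limit_ne_zero {K : Set (ℝ × ℝ)} (hK : IsClosed K) {k : ℤ}
    {π : ℕ → ℕ} {m : ℕ} (hm : 2 * (1 / 2) ^ m < (squareMeasure k).real K)
    (hπ : ∀ n ≥ m, π n ∉ badPositions K k ((List.range n).map π) m) :
    squareMeasure k {p | ∃ q : ℚ, (p.1, rademacherSeries π p.1 + (q : ℝ)) ∈ K} ≠ 0 := by
  intro h0
  have hlim : Tendsto (fun n => ∫ p, spliceIndicator K π m n p ∂squareMeasure k) atTop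
      (nhds (∫ _, (0 : ℝ) ∂squareMeasure k)) := by
    refine tendsto_integral_of_dominated_convergence (fun _ => 1)
      (fun n => (measurable_spliceIndicator hK.measurableSet π m n).aestronglyMeasurable)
      (integrable_const _) (fun n => .of_forall fun p => abs_spliceIndicator_le K π m n p) ?_
    filter_upwards [measure_eq_zero_iff_ae_notMem.1 h0] with p hp
    obtain ⟨q, hq⟩ := exists_rat_tendsto_spliceDigits π m p
    have hpq : (p.1, rademacherSeries π p.1 + (q : ℝ)) ∈ Kᶜ := fun h => hp ⟨q, h⟩
    have := (tendsto_const_nhds.prodMk_nhds hq).eventually (hK.isOpen_compl.mem_nhds hpq)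
    refine tendsto_const_nhds.congr' ?_
    filter_upwards [this] with n hn
    exact (indicator_of_notMem hn 1).symm
  have hge := ge_of_tendsto hlim (b := (squareMeasure k).real K - 2 * (1 / 2) ^ m) <| by
    filter_upwards [eventually_ge_atTop m] with n hn
    have := integral_spliceIndicator_ge hK.measurableSet k hπ hn
    have h2 : (0 : ℝ) ≤ 2 * (1 / 2) ^ n := by positivity
    linarith
  simp only [integral_zero] at hge
  linarith

theorem exists_int_measure_inter_Ico_pos {B : Set ℝ} (hB : 0 < volume B) :
    ∃ k : ℤ, 0 < volume (B ∩ Ico (k : ℝ) (k + 1)) := by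
  by_contra! h
  refine hB.ne' (measure_mono_null (t := ⋃ k : ℤ, B ∩ Ico (k : ℝ) (k + 1)) (fun x hx => ?_)
    (measure_iUnion_null fun k => nonpos_iff_eq_zero.1 (h k)))
  exact mem_iUnion.2 ⟨⌊x⌋, hx, Int.floor_le x, Int.lt_floor_add_one x⟩

theorem squareMeasure_prod_univ (k : ℤ) (A : Set ℝ) :
    squareMeasure k (A ×ˢ Set.univ) = volume.restrict (Ico (k : ℝ) (k + 1)) A := by
  rw [squareMeasure, Measure.prod_prod, measure_univ, mul_one]

theorem squareMeasure_absolutelyContinuous (k : ℤ) : squareMeasure k ≪ volume := by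
  rw [Measure.volume_eq_prod]
  exact Measure.restrict_le_self.absolutelyContinuous.prod
    Measure.restrict_le_self.absolutelyContinuous

/-- For every null set `H` and every set `B` of positive measure, the map `rademacherSeries π`
avoids `H` on a non-null part of `B`, provided that, from some point on, no value of `π` belongs to
a finite set of size at most `8 ^ n` that is determined by the `n` previous values. -/
theorem exists_finset_measure_rademacherSeries_ne_zero {H : Set (ℝ × ℝ)} (hH : volume H = 0)
    {B : Set ℝ} (hB : MeasurableSet B) (hB0 : 0 < volume B) :
    ∃ bad : List ℕ → Finset ℕ, (∀ s, (bad s).card ≤ 8 ^ s.length) ∧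
      ∀ π : ℕ → ℕ, (∀ᶠ n in atTop, π n ∉ bad ((List.range n).map π)) →
        volume {x | x ∈ B ∧ (x, rademacherSeries π x) ∉ H} ≠ 0 := by
  obtain ⟨k, hk⟩ := exists_int_measure_inter_Ico_pos hB0
  let H' : Set (ℝ × ℝ) := ⋃ q : ℚ, (fun p => p + (0, (q : ℝ))) ⁻¹' toMeasurable volume H
  have hH'0 : volume H' = 0 := measure_iUnion_null fun q => by
    rw [measure_preimage_add_right, measure_toMeasurable, hH]
  have hH'm : MeasurableSet H' := .iUnion fun q =>
    (measurable_add_const _) (measurableSet_toMeasurable _ _)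
  have hpos : squareMeasure k (B ×ˢ Set.univ \ H') ≠ 0 := by
    rw [measure_sdiff_null (squareMeasure_absolutelyContinuous k hH'0), squareMeasure_prod_univ,
      Measure.restrict_apply hB]
    exact hk.ne'
  obtain ⟨K, hKsub, hKc, hK0⟩ := ((hB.prod .univ).diff hH'm).exists_lt_isCompact
    (pos_iff_ne_zero.2 hpos)
  have hK := hKc.isClosed
  have hKm := hK.measurableSet
  let bad : List ℕ → Finset ℕ := fun s =>
    (Finset.range (s.length + 1)).biUnion fun m => (finite_badPositions hKm k s m).toFinset
  refine ⟨bad, fun s => ?_, fun π hπ => ?_⟩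
  · refine Finset.card_biUnion_le.trans ((Finset.sum_le_card_nsmul _ _ (4 ^ s.length)
      fun m _ => card_le_of_subset_badPositions hKm k s m _ (by simp)).trans ?_)
    have h8 : 8 ^ s.length = 2 ^ s.length * 4 ^ s.length := by rw [← mul_pow]; norm_num
    rw [h8, Finset.card_range, smul_eq_mul]
    exact Nat.mul_le_mul_right _ Nat.lt_two_pow_self
  · have hKr : 0 < (squareMeasure k).real K := ENNReal.toReal_pos hK0.ne' (measure_ne_top _ _)
    have hsmall : ∀ᶠ m : ℕ in atTop, 2 * (1 / 2 : ℝ) ^ m < (squareMeasure k).real K := by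
      have h := (tendsto_pow_atTop_nhds_zero_of_lt_one (r := (1 / 2 : ℝ)) (by norm_num)
        (by norm_num)).const_mul 2
      rw [mul_zero] at h
      exact h.eventually_lt_const hKr
    obtain ⟨m, hm, hmπ⟩ := (hsmall.and (eventually_forall_ge_atTop.2 hπ)).exists
    have hne := squareMeasure_limit_ne_zero hK hm (π := π) fun n hn hmem => by
      refine hmπ n hn (Finset.mem_biUnion.2 ⟨m, ?_, by simpa using hmem⟩)
      simpa using Nat.lt_succ_of_le hn
    intro h0
    refine hne (measure_mono_null (t := {x | x ∈ B ∧ (x, rademacherSeries π x) ∉ H} ×ˢ Set.univ) ?_ ?_)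
    · rintro ⟨x, y⟩ ⟨q, hq⟩
      obtain ⟨hxB, hxH⟩ := hKsub hq
      refine ⟨⟨hxB.1, fun hx => hxH (mem_iUnion.2 ⟨-q, ?_⟩)⟩, mem_univ _⟩
      simpa using subset_toMeasurable volume H hx
    · rw [squareMeasure_prod_univ]
      exact Measure.restrict_le_self.absolutelyContinuous h0

theorem nonStarN_le_of_forall (P : Set (ℕ → ℕ))
    (hP : ∀ bad : List ℕ → Finset ℕ, (∀ s, (bad s).card ≤ 8 ^ s.length) →
      ∃ π ∈ P, ∀ᶠ n in atTop, π n ∉ bad ((List.range n).map π)) :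
    nonStarN ≤ #P := by
  refine le_trans (csInf_le' ⟨rademacherSeries '' P, rfl, ?_, fun H hH B hB hB0 => ?_⟩)
    mk_image_le
  · rintro _ ⟨π, -, rfl⟩
    exact measurable_rademacherSeries π
  · obtain ⟨bad, hcard, hbad⟩ := exists_finset_measure_rademacherSeries_ne_zero hH hB hB0
    obtain ⟨π, hπ, hev⟩ := hP bad hcard
    exact ⟨_, mem_image_of_mem _ hπ, hbad π hev⟩

/-- The function whose value at `n` is given by `Q` applied to the list of the previous values. -/
def ofHistory (Q : List ℕ → ℕ) (n : ℕ) : ℕ :=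
  Q ((n.rec [] fun _ l => l ++ [Q l] : List ℕ))

theorem map_range_ofHistory (Q : List ℕ → ℕ) (n : ℕ) :
    (List.range n).map (ofHistory Q) = n.rec [] fun _ l => l ++ [Q l] := by
  induction n with
  | zero => rfl
  | succ n ih => rw [List.range_succ, List.map_append, ih]; rfl

theorem ofHistory_eq (Q : List ℕ → ℕ) (n : ℕ) :
    ofHistory Q n = Q ((List.range n).map (ofHistory Q)) := by
  rw [map_range_ofHistory, ofHistory]

theorem nonStarN_le_frakd : nonStarN ≤ frakd := by
  obtain ⟨D, hD, hdom⟩ := csInf_mem (s := { c : Cardinal | ∃ F : Set (ℕ → ℕ), #F = c ∧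
    ∀ g : ℕ → ℕ, ∃ f ∈ F, ∀ᶠ n in atTop, g n ≤ f n })
    ⟨_, Set.univ, rfl, fun g => ⟨g, mem_univ _, .of_forall fun _ => le_rfl⟩⟩
  change _ = frakd at hD
  rw [← hD]
  refine le_trans (nonStarN_le_of_forall
    ((fun g => ofHistory fun s => g (Encodable.encode s) + 1) '' D) fun bad _ => ?_) mk_image_le
  obtain ⟨g, hg, hle⟩ := hdom fun c => ((Encodable.decode c).map fun s => (bad s).sup id).getD 0
  refine ⟨_, mem_image_of_mem _ hg, ?_⟩
  set π := ofHistory fun s => g (Encodable.encode s) + 1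
  have hinj : Function.Injective fun n => Encodable.encode ((List.range n).map π) := by
    intro a b hab
    simpa using congrArg List.length (Encodable.encode_injective hab)
  filter_upwards [hinj.nat_tendsto_atTop.eventually hle] with n hn hmem
  rw [Encodable.encodek] at hn
  have h1 := (Finset.le_sup (f := id) hmem).trans hn
  have h2 : π n = g (Encodable.encode ((List.range n).map π)) + 1 := ofHistory_eq _ n
  simp only [id] at h1
  omega

open PiNat in
theorem exists_cylinder_subset_of_dense {U : Set Cantor} (hU : IsOpen U) (hd : Dense U) (l : ℕ) :
    ∃ l' ≥ l, ∀ u, ∃ v ∈ cylinder u l, cylinder v l' ⊆ U := by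
  have h : ∀ u, ∃ v ∈ cylinder u l, ∃ N, cylinder v N ⊆ U := by
    intro u
    obtain ⟨v, hv, hvU⟩ := hd.inter_open_nonempty _ (isOpen_cylinder _ u l)
      ⟨u, self_mem_cylinder u l⟩
    obtain ⟨_, ⟨x, N, rfl⟩, hvN, hNU⟩ :=
      (isTopologicalBasis_cylinders fun _ : ℕ => ZMod 2).exists_subset_of_mem_open hvU hU
    exact ⟨v, hv, N, by rwa [mem_cylinder_iff_eq.1 hvN]⟩
  choose v hv N hN using h
  let e : (Fin l → ZMod 2) → Cantor := fun τ i => if h : i < l then τ ⟨i, h⟩ else 0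
  refine ⟨max l (Finset.univ.sup fun τ => N (e τ)), le_max_left _ _, fun u => ?_⟩
  have hu : e (fun i => u i) ∈ cylinder u l := fun i hi => by simp [e, hi]
  refine ⟨v (e fun i => u i), ?_, (cylinder_anti _ ?_).trans (hN (e fun i => u i))⟩
  · rw [← mem_cylinder_iff_eq.1 hu]
    exact hv _
  · exact (Finset.le_sup (f := fun τ => N (e τ))
      (Finset.mem_univ fun i : Fin l => u i)).trans (le_max_right _ _)

open PiNat in
theorem exists_cylinder_sub_subset_of_dense {U : Set Cantor} (hU : IsOpen U) (hd : Dense U)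
    (l s : ℕ) : ∃ l' ≥ l, ∀ u, ∀ ts : List Cantor, ts.length ≤ s →
      ∃ v ∈ cylinder u l, ∀ t ∈ ts, cylinder (v - t) l' ⊆ U := by
  induction s with
  | zero =>
    refine ⟨l, le_rfl, fun u ts hts => ⟨u, self_mem_cylinder u l, ?_⟩⟩
    simp [List.length_eq_zero_iff.1 (Nat.le_zero.1 hts)]
  | succ s ih =>
    obtain ⟨l₁, hl₁, h₁⟩ := ih
    obtain ⟨l₂, hl₂, h₂⟩ := exists_cylinder_subset_of_dense hU hd l₁
    refine ⟨l₂, hl₁.trans hl₂, fun u ts hts => ?_⟩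
    rcases ts with _ | ⟨t, ts⟩
    · exact ⟨u, self_mem_cylinder u l, by simp⟩
    obtain ⟨v, hv, hvt⟩ := h₁ u ts (by simpa using hts)
    obtain ⟨w, hw, hwU⟩ := h₂ (v - t)
    have hwv : ∀ i < l₁, (w + t) i = v i := fun i hi => by simp [hw i hi]
    refine ⟨w + t, fun i hi => (hwv i (hi.trans_le hl₁)).trans (hv i hi), fun t' ht' => ?_⟩
    rcases List.mem_cons.1 ht' with rfl | ht'
    · simpa using hwU
    · refine fun x hx => hvt t' ht' fun i hi => ?_
      rw [hx i (hi.trans_le hl₂), Pi.sub_apply, Pi.sub_apply, hwv i hi]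

theorem exists_antitone_of_isMeagre {F : Set Cantor} (hF : IsMeagre F) :
    ∃ V : ℕ → Set Cantor, Antitone V ∧ (∀ n, IsOpen (V n)) ∧ (∀ n, Dense (V n)) ∧
      ∀ f ∈ F, ∃ n, f ∉ V n := by
  obtain ⟨S, hSo, hSd, hSc, hS⟩ := mem_residual_iff.1 hF
  obtain ⟨U, hU⟩ := (hSc.insert Set.univ).exists_eq_range (insert_nonempty _ _)
  have hUo : ∀ n, IsOpen (U n) := by
    intro n
    rcases hU.symm ▸ mem_range_self n with h | h
    · exact h ▸ isOpen_univ
    · exact hSo _ h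
  have hUd : ∀ n, Dense (U n) := by
    intro n
    rcases hU.symm ▸ mem_range_self n with h | h
    · exact h ▸ dense_univ
    · exact hSd _ h
  refine ⟨fun n => n.rec (U 0) fun n V => V ∩ U (n + 1), antitone_nat_of_succ_le fun n =>
    inter_subset_left, fun n => ?_, fun n => ?_, fun f hf => ?_⟩
  · induction n with
    | zero => exact hUo 0
    | succ n ih => exact ih.inter (hUo _)
  · induction n with
    | zero => exact hUd 0
    | succ n ih => exact ih.inter_of_isOpen_right (hUd _) (hUo _)
  · by_contra! h
    refine hS (mem_sInter.2 fun A hA => ?_) hf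
    obtain ⟨n, rfl⟩ : A ∈ range U := hU ▸ mem_insert_of_mem _ hA
    cases n with
    | zero => exact h 0
    | succ n => exact (h (n + 1)).2

open PiNat in
/-- For a meagre set `F` there are lengths `m n` such that, whenever for each `n` at most
`s n (m n)` elements of the Cantor space are given, some translate of `F` has no element that agrees
for infinitely many `n` with a given one below `m (n + 1)`. -/
theorem exists_strictMono_of_isMeagre {F : Set Cantor} (hF : IsMeagre F) (s : ℕ → ℕ → ℕ) :
    ∃ m : ℕ → ℕ, StrictMono m ∧ ∀ T : ℕ → List Cantor, (∀ n, (T n).length ≤ s n (m n)) →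
      ∃ y, ∀ f ∈ F, ∀ᶠ n in atTop, ∀ t ∈ T n, f ∉ cylinder (y - t) (m (n + 1)) := by
  obtain ⟨V, hanti, hVo, hVd, hV⟩ := exists_antitone_of_isMeagre hF
  choose L hL hLV using fun n l =>
    exists_cylinder_sub_subset_of_dense (hVo n) (hVd n) (l + 1) (s n l)
  let m : ℕ → ℕ := fun n => n.rec 0 L
  have hm : StrictMono m := strictMono_nat_of_lt_succ fun n => hL n (m n)
  refine ⟨m, hm, fun T hT => ?_⟩
  choose w hw hwV using fun n u => hLV n (m n) u (T n) (hT n)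
  let u : ℕ → Cantor := fun n => n.rec 0 w
  have hu : ∀ a b, a ≤ b → ∀ i < m a, u b i = u a i := by
    intro a b hab i hi
    induction b, hab using Nat.le_induction with
    | base => rfl
    | succ b hab ih =>
      rw [← ih]
      exact hw b (u b) i ((hi.trans_le (hm.monotone hab)).trans (Nat.lt_succ_self _))
  have hy : ∀ n, ∀ i < m n, u (i + 1) i = u n i := by
    intro n i hi
    rcases le_total n (i + 1) with h | h
    · exact hu _ _ h i hi
    · exact (hu _ _ h i (hm.id_le (i + 1))).symm
  refine ⟨fun i => u (i + 1) i, fun f hf => ?_⟩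
  obtain ⟨N, hN⟩ := hV f hf
  filter_upwards [eventually_ge_atTop N] with n hn t ht hft
  refine hN (hanti hn (hwV n (u n) t ht fun i hi => ?_))
  rw [hft i hi, Pi.sub_apply, Pi.sub_apply, hy (n + 1) i hi]

/-- Codes of the restrictions of `a` to its first `m (n + 1)` coordinates. -/
def restrictCode (m : ℕ → ℕ) (a : Cantor) (n : ℕ) : ℕ :=
  Encodable.encode ((List.range (m (n + 1))).map fun i => (a i).val)

theorem restrictCode_eq_iff {m : ℕ → ℕ} {a b : Cantor} {n : ℕ} :
    restrictCode m a n = restrictCode m b n ↔ ∀ i < m (n + 1), a i = b i := by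
  simp [restrictCode, (ZMod.val_injective 2).eq_iff]

theorem isMeagre_singleton_zero : IsMeagre ({0} : Set Cantor) := by
  refine residual_of_dense_open isClosed_singleton.isOpen_compl ?_
  rw [← interior_eq_empty_iff_dense_compl, eq_empty_iff_forall_notMem]
  intro x hx
  obtain ⟨_, ⟨z, N, rfl⟩, hxN, hN⟩ :=
    (PiNat.isTopologicalBasis_cylinders fun _ : ℕ => ZMod 2).exists_subset_of_mem_open
      hx isOpen_interior
  rw [← PiNat.mem_cylinder_iff_eq.1 hxN] at hN
  have h := interior_subset (hN (PiNat.update_mem_cylinder x N (x N + 1)))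
  have h' := interior_subset hx
  rw [mem_singleton_iff] at h h'
  have := congrFun h N
  simp [h'] at this

theorem nonStarN_le_nonSN : nonStarN ≤ nonSN := by
  obtain ⟨X, hX, hXS⟩ := csInf_mem (s := { c : Cardinal | ∃ X : Set Cantor, #X = c ∧
    ¬ HasStrongMeasureZero X }) ⟨_, Set.univ, rfl, fun h =>
      h {0} isMeagre_singleton_zero (by simp)⟩
  change _ = nonSN at hX
  rw [← hX]
  unfold HasStrongMeasureZero at hXS
  push Not at hXS
  obtain ⟨F, hF, hXF⟩ := hXS
  obtain ⟨m, hm, hmF⟩ := exists_strictMono_of_isMeagre hF fun n l => 2 ^ l * 8 ^ n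
  refine le_trans (nonStarN_le_of_forall (restrictCode m '' X) fun bad hbad => ?_) mk_image_le
  let e : ∀ n, (Fin (m n) → ZMod 2) → Cantor := fun n τ i => if h : i < m n then τ ⟨i, h⟩ else 0
  let E : ℕ → Finset ℕ := fun n =>
    Finset.univ.biUnion fun τ => bad ((List.range n).map (restrictCode m (e n τ)))
  have hE : ∀ n, (E n).card ≤ 2 ^ m n * 8 ^ n := by
    intro n
    refine Finset.card_biUnion_le.trans ((Finset.sum_le_card_nsmul _ _ (8 ^ n)
      fun τ _ => (hbad _).trans_eq (by simp)).trans_eq ?_)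
    simp [ZMod.card]
  obtain ⟨y, hy⟩ := hmF
    (fun n => (E n).toList.map (Function.invFun fun a => restrictCode m a n))
    fun n => by simpa using hE n
  obtain ⟨a, ha, f, hf, rfl⟩ : y ∈ X + F := hXF ▸ mem_univ y
  refine ⟨_, mem_image_of_mem _ ha, ?_⟩
  filter_upwards [hy f hf] with n hn hmem
  have hhist : (List.range n).map (restrictCode m a) =
      (List.range n).map (restrictCode m (e n fun i => a i)) := by
    refine List.map_congr_left fun j hj => restrictCode_eq_iff.2 fun i hi => ?_
    have : i < m n := hi.trans_le (hm.monotone (List.mem_range.1 hj))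
    simp [e, this]
  have hmemE : restrictCode m a n ∈ E n :=
    Finset.mem_biUnion.2 ⟨fun i => a i, Finset.mem_univ _, hhist ▸ hmem⟩
  refine hn _ (List.mem_map_of_mem (Finset.mem_toList.2 hmemE)) fun i hi => ?_
  have := restrictCode_eq_iff.1 (Function.invFun_eq (f := fun a => restrictCode m a n) ⟨a, rfl⟩)
    i hi
  simp [this]

/-- `non*(𝒩) ≤ min {𝔡, non(𝒮𝒩)}`. -/
theorem nonStarN_le_min : nonStarN ≤ min frakd nonSN := by
  exact le_min nonStarN_le_frakd nonStarN_le_nonSN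
end
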